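/- There exist universal constants C > 0 and c > 0 with the following property. Let t > 0, ε > 0, M ≥ 1 with M·ε·t^{1/3} ≤ c, and let u : ℝ → ℝ be a Schwartz function satisfying the bootstrap bounds with constants M, ε at time t, as well as ‖u‖_{Ḃ^{-1/2}_{2,∞}} + ‖L^{NL}u(t)‖_{Ḣ^{1/2}} ≤ ε. Then for all x ∈ ℝ: t^{1/4}⟨x⟩^{1/4}|u(x)| + t^{3/4}⟨x⟩^{-1/4}|u'(x)| ≤ C·ε. In particular the constant C does not depend on M. -/

import Mathlib

open MeasureTheory Real SchwartzMap Set
open scoped FourierTransform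

noncomputable section

/-- Fourier transform of a real-valued function on `ℝ`. -/
def FT (u : ℝ → ℝ) : ℝ → ℂ := 𝓕 (fun x => (u x : ℂ))

/-- Homogeneous Sobolev norm `‖u‖_{Ḣˢ}`. -/
def HsNorm (s : ℝ) (u : ℝ → ℝ) : ℝ :=
  (∫ ξ : ℝ, |ξ| ^ (2 * s) * ‖FT u ξ‖ ^ 2) ^ (1/2 : ℝ)

/-- Homogeneous Besov norm `‖u‖_{Ḃ^{-1/2}_{2,∞}}`. -/
def BesovNorm (u : ℝ → ℝ) : ℝ :=
  ⨆ j : ℤ, (2:ℝ) ^ (-(j:ℝ)/2) *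
    (∫ ξ in {ξ : ℝ | (2:ℝ)^j ≤ |ξ| ∧ |ξ| < (2:ℝ)^(j+1)}, ‖FT u ξ‖^2) ^ (1/2:ℝ)

/-- `L²` norm. -/
def L2Norm (u : ℝ → ℝ) : ℝ := (∫ x : ℝ, u x ^ 2) ^ (1/2:ℝ)

/-- `L²` norm restricted to a set. -/
def L2NormOn (A : Set ℝ) (u : ℝ → ℝ) : ℝ := (∫ x in A, u x ^ 2) ^ (1/2:ℝ)

/-- The time-dependent japanese bracket `⟨x⟩ = (x² + t^{2/3})^{1/2}`. -/
def jb (t x : ℝ) : ℝ := (x^2 + t ^ ((2:ℝ)/3)) ^ (1/2:ℝ)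

/-- The bootstrap bounds with constants `M`, `ε` at time `t`. -/
def Bootstrap (M ε t : ℝ) (u : ℝ → ℝ) : Prop :=
  ∀ x : ℝ, |u x| ≤ M * ε * t ^ (-(1:ℝ)/4) * jb t x ^ (-(1:ℝ)/4) ∧
    |deriv u x| ≤ M * ε * t ^ (-(3:ℝ)/4) * jb t x ^ ((1:ℝ)/4)

/-- The nonlinear operator `L^{NL}u(t)(x) = x·u(x) - 3t·u''(x) + 9t·u(x)²`. -/
def LNL (t : ℝ) (u : ℝ → ℝ) : ℝ → ℝ :=
  fun x => x * u x - 3 * t * iteratedDeriv 2 u x + 9 * t * u x ^ 2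

theorem sq_integral_le_mul_integral_sq {g : ℝ → ℝ} (hg : Continuous g) {p q : ℝ} (hpq : p ≤ q) :
    (∫ s in p..q, g s) ^ 2 ≤ (q - p) * ∫ s in p..q, g s ^ 2 := by
  rcases hpq.eq_or_lt with rfl | hlt
  · simp
  set J := ∫ s in p..q, g s with hJ
  have hd : 0 < q - p := sub_pos.2 hlt
  have h0 : 0 ≤ ∫ s in p..q, (g s - J / (q - p)) ^ 2 :=
    intervalIntegral.integral_nonneg hpq fun s _ => sq_nonneg _
  have h1 : (∫ s in p..q, (g s - J / (q - p)) ^ 2)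
      = (∫ s in p..q, g s ^ 2) - J ^ 2 / (q - p) := by
    have : ∀ s, (g s - J / (q - p)) ^ 2
        = g s ^ 2 - (2 * (J / (q - p)) * g s - (J / (q - p)) ^ 2) := fun s => by ring
    simp only [this]
    rw [intervalIntegral.integral_sub, intervalIntegral.integral_sub,
      intervalIntegral.integral_const_mul, intervalIntegral.integral_const, ← hJ, smul_eq_mul]
    · field_simp
      ring
    all_goals exact (by fun_prop : Continuous _).intervalIntegrable _ _
  rw [h1, sub_nonneg, div_le_iff₀ hd] at h0
  linarith

theorem sq_apply_le_integral_sq {g g₁ : ℝ → ℝ} (hg : ∀ x, HasDerivAt g (g₁ x) x)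
    (hc : Continuous g₁) (x₀ : ℝ) {R θ : ℝ} (hR : 0 < R) (hθ : 0 < θ) :
    g x₀ ^ 2 ≤ (R⁻¹ + θ) * (∫ s in (x₀ - R)..x₀, g s ^ 2)
      + θ⁻¹ * ∫ s in (x₀ - R)..x₀, g₁ s ^ 2 := by
  have hgc : Continuous g := continuous_iff_continuousAt.2 fun x => (hg x).continuousAt
  have key : (∫ s in (x₀ - R)..x₀, (g s ^ 2 + (s - (x₀ - R)) * (2 * g s * g₁ s)))
      = R * g x₀ ^ 2 := by
    rw [intervalIntegral.integral_eq_sub_of_hasDerivAt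
      (f := fun s => (s - (x₀ - R)) * g s ^ 2)]
    · ring
    · intro s _
      refine (((hasDerivAt_id' s).sub_const (x₀ - R)).fun_mul ((hg s).fun_pow 2)).congr_deriv ?_
      norm_num
    · exact (by fun_prop : Continuous _).intervalIntegrable _ _
  have hle : (∫ s in (x₀ - R)..x₀, (g s ^ 2 + (s - (x₀ - R)) * (2 * g s * g₁ s)))
      ≤ ∫ s in (x₀ - R)..x₀, ((1 + R * θ) * g s ^ 2 + (R * θ⁻¹) * g₁ s ^ 2) := by
    apply intervalIntegral.integral_mono_on (by linarith)
    · exact (by fun_prop : Continuous _).intervalIntegrable _ _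
    · exact (by fun_prop : Continuous _).intervalIntegrable _ _
    · intro s hs
      have h1 : 0 ≤ s - (x₀ - R) := by linarith [hs.1]
      have h2 : s - (x₀ - R) ≤ R := by linarith [hs.2]
      have h3 : 2 * g s * g₁ s ≤ θ * g s ^ 2 + θ⁻¹ * g₁ s ^ 2 := by
        have : θ * g s ^ 2 + θ⁻¹ * g₁ s ^ 2 - 2 * g s * g₁ s = θ⁻¹ * (θ * g s - g₁ s) ^ 2 := by
          field_simp
          ring
        nlinarith [mul_nonneg (inv_nonneg.2 hθ.le) (sq_nonneg (θ * g s - g₁ s))]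
      have h4 : 0 ≤ θ * g s ^ 2 + θ⁻¹ * g₁ s ^ 2 := by positivity
      nlinarith [mul_le_mul_of_nonneg_left h3 h1, mul_le_mul_of_nonneg_right h2 h4]
  rw [key, intervalIntegral.integral_add, intervalIntegral.integral_const_mul,
    intervalIntegral.integral_const_mul] at hle
  · refine le_of_mul_le_mul_left (hle.trans (le_of_eq ?_)) hR
    field_simp
  all_goals exact (by fun_prop : Continuous _).intervalIntegrable _ _

/-- Physical-space control by the seminorm of `B^{1/2}_{2,∞}`. -/
def ShiftBound (E : ℝ) (g : ℝ → ℝ) : Prop :=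
  ∀ a : ℝ, 0 < a → ∀ p q : ℝ, p ≤ q → ∫ s in p..q, (g (s + a) - g s) ^ 2 ≤ a * E

theorem ShiftBound.nonneg {E : ℝ} {g : ℝ → ℝ} (h : ShiftBound E g) : 0 ≤ E := by
  simpa using h 1 one_pos 0 0 le_rfl

theorem ShiftBound.exists_approx {E : ℝ} {g : ℝ → ℝ} (h : ShiftBound E g) (hg : Continuous g)
    {a : ℝ} (ha : 0 < a) :
    ∃ k k₁ : ℝ → ℝ, (∀ x, HasDerivAt k (k₁ x) x) ∧ Continuous k₁ ∧
      ∀ p q : ℝ, p ≤ q →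
        (∫ s in p..q, (g s - k s) ^ 2) ≤ a * E ∧ (∫ s in p..q, k₁ s ^ 2) ≤ a⁻¹ * E := by
  have hG : ∀ x, HasDerivAt (fun x => ∫ s in (0:ℝ)..x, g s) (g x) x := fun x =>
    intervalIntegral.integral_hasDerivAt_right (hg.intervalIntegrable _ _)
      hg.stronglyMeasurable.stronglyMeasurableAtFilter hg.continuousAt
  have hk : ∀ x, HasDerivAt
      (fun x => a⁻¹ * ((∫ s in (0:ℝ)..(x + a), g s) - ∫ s in (0:ℝ)..x, g s))
      (a⁻¹ * (g (x + a) - g x)) x := fun x =>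
    (((hG (x + a)).comp_add_const x a).sub (hG x)).const_mul _
  refine ⟨_, _, hk, by fun_prop, fun p q hpq => ⟨?_, ?_⟩⟩
  · have hkc : Continuous (fun x => a⁻¹ * ((∫ s in (0:ℝ)..(x + a), g s) - ∫ s in (0:ℝ)..x, g s)) :=
      continuous_iff_continuousAt.2 fun x => (hk x).continuousAt
    have hptw : ∀ s, (g s - a⁻¹ * ((∫ s in (0:ℝ)..(s + a), g s) - ∫ s in (0:ℝ)..s, g s)) ^ 2
        ≤ a⁻¹ * ∫ τ in (0:ℝ)..a, (g (s + τ) - g s) ^ 2 := by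
      intro s
      have h1 : (∫ s in (0:ℝ)..(s + a), g s) - (∫ s in (0:ℝ)..s, g s)
          = ∫ τ in (0:ℝ)..a, g (s + τ) := by
        rw [intervalIntegral.integral_interval_sub_left (hg.intervalIntegrable _ _)
          (hg.intervalIntegrable _ _), intervalIntegral.integral_comp_add_left (fun x => g x)]
        simp
      have h2 : (∫ τ in (0:ℝ)..a, (g (s + τ) - g s)) = (∫ τ in (0:ℝ)..a, g (s + τ)) - a * g s := by
        rw [intervalIntegral.integral_sub]
        · simp
        all_goals exact (by fun_prop : Continuous _).intervalIntegrable _ _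
      have h3 := sq_integral_le_mul_integral_sq (g := fun τ => g (s + τ) - g s) (by fun_prop) ha.le
      rw [h2, sub_zero] at h3
      rw [h1]
      have h4 : (g s - a⁻¹ * ∫ τ in (0:ℝ)..a, g (s + τ)) ^ 2
          = a⁻¹ * a⁻¹ * ((∫ τ in (0:ℝ)..a, g (s + τ)) - a * g s) ^ 2 := by
        field_simp
        ring
      rw [h4, mul_assoc]
      refine mul_le_mul_of_nonneg_left ?_ (by positivity)
      rw [inv_mul_le_iff₀ ha]
      exact h3
    have hcont : Continuous (Function.uncurry fun s τ => (g (s + τ) - g s) ^ 2) := by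
      unfold Function.uncurry
      fun_prop
    calc _ ≤ ∫ s in p..q, a⁻¹ * ∫ τ in (0:ℝ)..a, (g (s + τ) - g s) ^ 2 := by
          apply intervalIntegral.integral_mono_on hpq
          · exact (by fun_prop : Continuous _).intervalIntegrable _ _
          · refine Continuous.intervalIntegrable ?_ _ _
            exact continuous_const.mul
              (intervalIntegral.continuous_parametric_intervalIntegral_of_continuous' hcont _ _)
          · exact fun s _ => hptw s
      _ = a⁻¹ * ∫ τ in (0:ℝ)..a, ∫ s in p..q, (g (s + τ) - g s) ^ 2 := by
          rw [intervalIntegral.integral_const_mul,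
            intervalIntegral_intervalIntegral_swap
              ((hcont.continuousOn.integrableOn_compact (isCompact_uIcc.prod isCompact_uIcc)).mono_set
                (prod_mono uIoc_subset_uIcc uIoc_subset_uIcc))]
      _ ≤ a⁻¹ * ∫ τ in (0:ℝ)..a, a * E := by
          refine mul_le_mul_of_nonneg_left ?_ (by positivity)
          apply intervalIntegral.integral_mono_on ha.le
          · refine Continuous.intervalIntegrable ?_ _ _
            refine intervalIntegral.continuous_parametric_intervalIntegral_of_continuous' ?_ _ _
            unfold Function.uncurry
            fun_prop
          · exact continuous_const.intervalIntegrable _ _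
          · intro τ hτ
            rcases hτ.1.eq_or_lt with rfl | hpos
            · simpa using mul_nonneg ha.le h.nonneg
            · exact (h τ hpos p q hpq).trans (mul_le_mul_of_nonneg_right hτ.2 h.nonneg)
      _ = a * E := by
          rw [intervalIntegral.integral_const, smul_eq_mul]
          field_simp
          ring
  · simp only [mul_pow]
    rw [intervalIntegral.integral_const_mul]
    calc _ ≤ (a⁻¹) ^ 2 * (a * E) := mul_le_mul_of_nonneg_left (h a ha p q hpq) (by positivity)
      _ = _ := by field_simp

theorem ShiftBound.exists_const {E : ℝ} {g : ℝ → ℝ} (h : ShiftBound E g) (hg : Continuous g)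
    {p q : ℝ} (hpq : p < q) :
    ∃ m : ℝ, ∫ s in p..q, (g s - m) ^ 2 ≤ 4 * (q - p) * E := by
  have hl : 0 < q - p := sub_pos.2 hpq
  obtain ⟨k, k₁, hk, hk₁, hb⟩ := h.exists_approx hg hl
  have hkc : Continuous k := continuous_iff_continuousAt.2 fun x => (hk x).continuousAt
  refine ⟨k p, ?_⟩
  have hosc : ∀ s ∈ Icc p q, (k s - k p) ^ 2 ≤ E := by
    intro s hs
    have h1 : k s - k p = ∫ x in p..s, k₁ x :=
      (intervalIntegral.integral_eq_sub_of_hasDerivAt (fun x _ => hk x)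
        (hk₁.intervalIntegrable _ _)).symm
    have h2 := (hb p s hs.1).2
    calc (k s - k p) ^ 2 ≤ (s - p) * ∫ x in p..s, k₁ x ^ 2 := by
          rw [h1]
          exact sq_integral_le_mul_integral_sq hk₁ hs.1
      _ ≤ (q - p) * ((q - p)⁻¹ * E) := by
          refine mul_le_mul (by linarith [hs.2]) h2 ?_ hl.le
          exact intervalIntegral.integral_nonneg hs.1 fun x _ => sq_nonneg _
      _ = E := by field_simp
  calc _ ≤ ∫ s in p..q, (2 * (g s - k s) ^ 2 + 2 * E) := by
        apply intervalIntegral.integral_mono_on hpq.le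
        · exact (by fun_prop : Continuous _).intervalIntegrable _ _
        · exact (by fun_prop : Continuous _).intervalIntegrable _ _
        · intro s hs
          nlinarith [hosc s hs, sq_nonneg ((g s - k s) - (k s - k p))]
    _ = 2 * (∫ s in p..q, (g s - k s) ^ 2) + 2 * E * (q - p) := by
        rw [intervalIntegral.integral_add, intervalIntegral.integral_const_mul,
          intervalIntegral.integral_const, smul_eq_mul]
        · ring
        all_goals exact (by fun_prop : Continuous _).intervalIntegrable _ _
    _ ≤ _ := by linarith [(hb p q hpq.le).1]

theorem sq_add_four_le (a b c d : ℝ) :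
    (a + b + c + d) ^ 2 ≤ 4 * (a ^ 2 + b ^ 2 + c ^ 2 + d ^ 2) := by
  linarith [sq_nonneg (a - b), sq_nonneg (a - c), sq_nonneg (a - d), sq_nonneg (b - c),
    sq_nonneg (b - d), sq_nonneg (c - d)]

theorem integral_le_of_le_linear_combination {F g₁ g₂ g₃ g₄ : ℝ → ℝ} (hF : Continuous F)
    (h₁ : Continuous g₁) (h₂ : Continuous g₂) (h₃ : Continuous g₃) (h₄ : Continuous g₄)
    {p q : ℝ} (hpq : p ≤ q) (c₁ c₂ c₃ c₄ : ℝ)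
    (h : ∀ s ∈ Icc p q, F s ≤ c₁ * g₁ s + c₂ * g₂ s + c₃ * g₃ s + c₄ * g₄ s) :
    ∫ s in p..q, F s ≤ c₁ * (∫ s in p..q, g₁ s) + c₂ * (∫ s in p..q, g₂ s)
      + c₃ * (∫ s in p..q, g₃ s) + c₄ * ∫ s in p..q, g₄ s := by
  have h0 := intervalIntegral.integral_mono_on (μ := volume) hpq (hF.intervalIntegrable p q)
    ((by fun_prop : Continuous fun s =>
      c₁ * g₁ s + c₂ * g₂ s + c₃ * g₃ s + c₄ * g₄ s).intervalIntegrable p q) h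
  rwa [intervalIntegral.integral_add, intervalIntegral.integral_add, intervalIntegral.integral_add,
    intervalIntegral.integral_const_mul, intervalIntegral.integral_const_mul,
    intervalIntegral.integral_const_mul, intervalIntegral.integral_const_mul] at h0
  all_goals exact (by fun_prop : Continuous _).intervalIntegrable _ _

theorem exists_bump (x₀ : ℝ) {R : ℝ} (hR : 0 < R) :
    ∃ φ φ₁ φ₂ : ℝ → ℝ, (∀ x, HasDerivAt φ (φ₁ x) x) ∧ (∀ x, HasDerivAt φ₁ (φ₂ x) x) ∧
      Continuous φ₂ ∧ φ (x₀ - 2 * R) = 0 ∧ φ (x₀ + R) = 0 ∧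
      φ₁ (x₀ - 2 * R) = 0 ∧ φ₁ (x₀ + R) = 0 ∧
      (∀ s ∈ Icc (x₀ - 2 * R) (x₀ + R),
        0 ≤ φ s ∧ φ s ≤ 6 ∧ |φ₁ s| ≤ 14 / R ∧ |φ₂ s| ≤ 18 / R ^ 2) ∧
      ∀ s ∈ Icc (x₀ - R) x₀, 4 ≤ φ s := by
  have hz : ∀ x : ℝ, HasDerivAt (fun s => (s - x₀) / R) (1 / R) x := fun x =>
    ((hasDerivAt_id' x).sub_const x₀).div_const R
  have hw : ∀ x : ℝ, HasDerivAt (fun s => ((s - x₀) / R) ^ 2 + (s - x₀) / R - 2)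
      ((2 * ((x - x₀) / R) + 1) / R) x := fun x =>
    ((((hz x).fun_pow 2).fun_add (hz x)).sub_const 2).congr_deriv (by norm_num; ring)
  refine ⟨fun s => (((s - x₀) / R) ^ 2 + (s - x₀) / R - 2) ^ 2,
    fun s => 2 * (((s - x₀) / R) ^ 2 + (s - x₀) / R - 2) * ((2 * ((s - x₀) / R) + 1) / R),
    fun s => (2 * (2 * ((s - x₀) / R) + 1) ^ 2
      + 4 * (((s - x₀) / R) ^ 2 + (s - x₀) / R - 2)) / R ^ 2, fun x => ?_, fun x => ?_,
      by fun_prop, ?_, ?_, ?_, ?_, ?_, ?_⟩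
  · exact ((hw x).fun_pow 2).congr_deriv (by norm_num)
  · refine (((hw x).const_mul 2).fun_mul ((((hz x).const_mul 2).add_const 1).div_const R)).congr_deriv ?_
    field_simp
    ring
  · field_simp
    ring
  · field_simp
    ring
  · field_simp
    ring
  · field_simp
    ring
  · intro s hs
    have h1 : -2 ≤ (s - x₀) / R := by rw [le_div_iff₀ hR]; linarith [hs.1]
    have h2 : (s - x₀) / R ≤ 1 := by rw [div_le_iff₀ hR]; linarith [hs.2]
    beta_reduce
    generalize (s - x₀) / R = z at h1 h2
    have h3 : z ^ 2 + z - 2 ≤ 0 := by nlinarith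
    have h4 : -(9 / 4) ≤ z ^ 2 + z - 2 := by nlinarith [sq_nonneg (2 * z + 1)]
    have h5 : |2 * z + 1| ≤ 3 := abs_le.2 ⟨by linarith, by linarith⟩
    have h6 : |z ^ 2 + z - 2| ≤ 9 / 4 := abs_le.2 ⟨h4, by linarith⟩
    refine ⟨sq_nonneg _, by nlinarith, ?_, ?_⟩
    · rw [abs_mul, abs_mul, abs_div, abs_of_pos hR, abs_two, mul_div_assoc']
      gcongr
      nlinarith [abs_nonneg (2 * z + 1), abs_nonneg (z ^ 2 + z - 2)]
    · rw [abs_div, abs_of_pos (by positivity : 0 < R ^ 2)]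
      gcongr
      exact abs_le.2 ⟨by nlinarith, by nlinarith⟩
  · intro s hs
    have h1 : -1 ≤ (s - x₀) / R := by rw [le_div_iff₀ hR]; linarith [hs.1]
    have h2 : (s - x₀) / R ≤ 0 := by rw [div_le_iff₀ hR]; linarith [hs.2]
    beta_reduce
    generalize (s - x₀) / R = z at h1 h2
    nlinarith [mul_nonneg (by linarith : 0 ≤ z + 1) (by linarith : 0 ≤ -z)]

/-- A solution of `-3 u'' + x u + 9 u² = f` of small amplitude, where `f` and the antiderivative
`U` of `u` have `B^{1/2}_{2,∞}` seminorms controlled by `E`. -/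
structure IsSmallSolution (E : ℝ) (U u u₁ u₂ f : ℝ → ℝ) : Prop where
  hasDerivAt_U : ∀ x, HasDerivAt U (u x) x
  hasDerivAt_u : ∀ x, HasDerivAt u (u₁ x) x
  hasDerivAt_u₁ : ∀ x, HasDerivAt u₁ (u₂ x) x
  continuous_u₂ : Continuous u₂
  eq : ∀ x, f x = x * u x - 3 * u₂ x + 9 * u x ^ 2
  small : ∀ x, |u x| ≤ 1 / 144
  shift_U : ShiftBound E U
  shift_f : ShiftBound E f

namespace IsSmallSolution

variable {E : ℝ} {U u u₁ u₂ f : ℝ → ℝ}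

theorem continuous_U (h : IsSmallSolution E U u u₁ u₂ f) : Continuous U :=
  continuous_iff_continuousAt.2 fun x => (h.hasDerivAt_U x).continuousAt

theorem continuous_u (h : IsSmallSolution E U u u₁ u₂ f) : Continuous u :=
  continuous_iff_continuousAt.2 fun x => (h.hasDerivAt_u x).continuousAt

theorem continuous_u₁ (h : IsSmallSolution E U u u₁ u₂ f) : Continuous u₁ :=
  continuous_iff_continuousAt.2 fun x => (h.hasDerivAt_u₁ x).continuousAt

theorem continuous_f (h : IsSmallSolution E U u u₁ u₂ f) : Continuous f := by
  have h1 := h.continuous_u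
  have h2 := h.continuous_u₂
  rw [funext h.eq]
  fun_prop

theorem integral_sq_le (h : IsSmallSolution E U u u₁ u₂ f) {x₀ r κ Y : ℝ} (hr : 1 ≤ r)
    (hκ : 0 < κ) (hκ4 : κ ≤ 1 / 4)
    (hY : ∀ s, |s - x₀| ≤ r ^ 4 / 2 → |u₁ s| ≤ Y * r) :
    ∫ s in (x₀ - 2 * (r ^ 4 / 4))..(x₀ + r ^ 4 / 4), u s ^ 2
      ≤ 2 * (E / κ + κ ^ 2 * Y ^ 2) * r ^ 2 := by
  have hr0 : 0 < r := by linarith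
  have hU := h.continuous_U
  have hu := h.continuous_u
  set a : ℝ := κ / r ^ 2 with ha
  have ha0 : 0 < a := by positivity
  have hr2 : 1 ≤ r ^ 2 := one_le_pow₀ hr
  have hr4 : 1 ≤ r ^ 4 := one_le_pow₀ hr
  have hale : a ≤ r ^ 4 / 4 := by
    calc a ≤ κ := div_le_self hκ.le hr2
      _ ≤ r ^ 4 / 4 := by linarith
  have hE := h.shift_U.nonneg
  have hptw : ∀ s ∈ Icc (x₀ - 2 * (r ^ 4 / 4)) (x₀ + r ^ 4 / 4),
      u s ^ 2 ≤ 2 / a ^ 2 * (U (s + a) - U s) ^ 2 + 2 * (a * (Y * r)) ^ 2 * 1 + 0 * 0 + 0 * 0 := by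
    intro s hs
    obtain ⟨ξ, hξ, hξU⟩ := exists_hasDerivAt_eq_slope U u (by linarith : s < s + a)
      hU.continuousOn fun x _ => h.hasDerivAt_U x
    obtain ⟨ζ, hζ, hζu⟩ := exists_hasDerivAt_eq_slope u u₁ hξ.1
      hu.continuousOn fun x _ => h.hasDerivAt_u x
    have hζb : |u₁ ζ| ≤ Y * r := by
      refine hY ζ (abs_le.2 ⟨?_, ?_⟩) <;> linarith [hs.1, hs.2, hζ.1, hζ.2, hξ.2]
    have hd : u ξ - u s = u₁ ζ * (ξ - s) := by
      rw [hζu]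
      field_simp [sub_ne_zero.2 hξ.1.ne']
    have hdb : (u ξ - u s) ^ 2 ≤ (a * (Y * r)) ^ 2 := by
      rw [hd, ← sq_abs, abs_mul, mul_comm, abs_of_pos (sub_pos.2 hξ.1)]
      have h1 : ξ - s ≤ a := by linarith [hξ.2]
      exact pow_le_pow_left₀ (mul_nonneg (sub_pos.2 hξ.1).le (abs_nonneg _))
        (mul_le_mul h1 hζb (abs_nonneg _) ha0.le) 2
    have hUu : (U (s + a) - U s) ^ 2 = a ^ 2 * u ξ ^ 2 := by
      rw [hξU, add_sub_cancel_left]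
      field_simp
    rw [hUu, div_mul_eq_mul_div, mul_comm, mul_comm (2 : ℝ)]
    have : a ^ 2 * u ξ ^ 2 * 2 / a ^ 2 = 2 * u ξ ^ 2 := by field_simp
    rw [this]
    nlinarith [sq_nonneg (u ξ + (u ξ - u s))]
  have hI := integral_le_of_le_linear_combination (p := x₀ - 2 * (r ^ 4 / 4)) (q := x₀ + r ^ 4 / 4)
    (by fun_prop) (by fun_prop) continuous_const continuous_const continuous_const
    (by linarith) _ _ _ _ hptw
  have hS := h.shift_U a ha0 (x₀ - 2 * (r ^ 4 / 4)) (x₀ + r ^ 4 / 4) (by linarith)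
  refine hI.trans ?_
  calc _ ≤ 2 / a ^ 2 * (a * E) + 2 * (a * (Y * r)) ^ 2 * (3 / 4 * r ^ 4) := by
        refine le_trans ?_ (add_le_add_left (mul_le_mul_of_nonneg_left hS (by positivity)) _)
        simp
        apply le_of_eq
        ring
    _ = 2 * (E / κ) * r ^ 2 + 3 / 2 * (κ ^ 2 * Y ^ 2) * r ^ 2 := by
        rw [ha]
        field_simp
        ring
    _ ≤ _ := by nlinarith [mul_nonneg (sq_nonneg (κ * Y)) (sq_nonneg r)]

theorem integral_source_sq_le (h : IsSmallSolution E U u u₁ u₂ f) {x₀ r D : ℝ} (hr : 1 ≤ r)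
    (hx₀ : |x₀| ≤ r ^ 4) (hED : E ≤ D)
    (hu2 : ∫ s in (x₀ - 2 * (r ^ 4 / 4))..(x₀ + r ^ 4 / 4), u s ^ 2 ≤ D * r ^ 2) :
    ∫ s in (x₀ - 2 * (r ^ 4 / 4))..(x₀ + r ^ 4 / 4), f s ^ 2 ≤ 4 * 10 ^ 6 * D * r ^ 4 := by
  have hU := h.continuous_U
  have hu := h.continuous_u
  have hu₁ := h.continuous_u₁
  have hu₂ := h.continuous_u₂
  have hf := h.continuous_f
  have hE := h.shift_U.nonneg
  have hr4 : 1 ≤ r ^ 4 := one_le_pow₀ hr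
  have hr2 : r ^ 2 ≤ r ^ 4 := pow_le_pow_right₀ hr (by norm_num)
  obtain ⟨R, hRdef⟩ : ∃ R, R = r ^ 4 / 4 := ⟨_, rfl⟩
  rw [← hRdef] at hu2 ⊢
  have hr4R : r ^ 4 = 4 * R := by linarith
  have hR : 0 < R := by linarith
  have hR4 : 1 / 4 ≤ R := by linarith
  rw [hr4R] at hr2 hx₀ ⊢
  obtain ⟨φ, φ₁, φ₂, hφ, hφ₁, hφ₂c, hφP, hφQ, hφ₁P, hφ₁Q, hφb, hφ4⟩ := exists_bump x₀ hR
  have hφc : Continuous φ := continuous_iff_continuousAt.2 fun x => (hφ x).continuousAt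
  have hφ₁c : Continuous φ₁ := continuous_iff_continuousAt.2 fun x => (hφ₁ x).continuousAt
  have hPQ : x₀ - 2 * R < x₀ + R := by linarith
  obtain ⟨m, hm⟩ := h.shift_U.exists_const hU hPQ
  obtain ⟨A, hA⟩ := h.shift_f.exists_const hf hPQ
  set P := x₀ - 2 * R with hP
  set Q := x₀ + R with hQ
  have hQP : Q - P = 3 * R := by rw [hP, hQ]; ring
  rw [hQP] at hm hA
  have hD : 0 ≤ D := hE.trans hED
  let W : ℝ → ℝ := fun s => -(φ s + s * φ₁ s) * (U s - m) - 3 * φ₂ s * u s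
    + 9 * φ s * u s ^ 2 - φ s * (f s - A)
  have hWc : Continuous W := by fun_prop
  have hWint : ∫ s in P..Q, (φ s * A - W s) = 0 := by
    have := intervalIntegral.integral_eq_sub_of_hasDerivAt (a := P) (b := Q)
      (f := fun s => s * φ s * (U s - m) + 3 * (φ₁ s * u s - φ s * u₁ s))
      (f' := fun s => φ s * A - W s) (fun s _ => ?_)
      ((by fun_prop : Continuous _).intervalIntegrable _ _)
    · rw [this, hφP, hφQ, hφ₁P, hφ₁Q]
      ring
    · refine ((((hasDerivAt_id' s).fun_mul (hφ s)).fun_mul ((h.hasDerivAt_U s).sub_const m)).fun_add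
        ((((hφ₁ s).fun_mul (h.hasDerivAt_u s)).fun_sub
          ((hφ s).fun_mul (h.hasDerivAt_u₁ s))).const_mul 3)).congr_deriv ?_
      simp only [W]
      rw [h.eq s]
      ring
  rw [intervalIntegral.integral_sub ((by fun_prop : Continuous _).intervalIntegrable _ _)
    (hWc.intervalIntegrable _ _), intervalIntegral.integral_mul_const, sub_eq_zero] at hWint
  have hφint : 4 * R ≤ ∫ s in P..Q, φ s := by
    calc 4 * R = ∫ s in (x₀ - R)..x₀, (4 : ℝ) := by simp; ring
      _ ≤ ∫ s in (x₀ - R)..x₀, φ s := by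
        refine intervalIntegral.integral_mono_on (by linarith) (by simp)
          (hφc.intervalIntegrable _ _) hφ4
      _ ≤ ∫ s in P..Q, φ s := by
        refine intervalIntegral.integral_mono_interval (by linarith) (by linarith) (by linarith) ?_
          (hφc.intervalIntegrable _ _)
        filter_upwards [ae_restrict_mem measurableSet_Ioc] with s hs
        exact (hφb s ⟨hs.1.le, hs.2⟩).1
  have hW2 : ∀ s ∈ Icc P Q, W s ^ 2 ≤ 4 * 8100 * (U s - m) ^ 2 + 4 * (54 ^ 2 * 256 + 1) * u s ^ 2
      + 4 * 36 * (f s - A) ^ 2 + 0 * 0 := by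
    intro s hs
    obtain ⟨h0, h6, h1, h2⟩ := hφb s hs
    have hsR : |s| ≤ 6 * R := by
      rw [abs_le] at hx₀ ⊢
      constructor <;> linarith [hs.1, hs.2, hx₀.1, hx₀.2]
    have hb1 : (φ s + s * φ₁ s) ^ 2 ≤ 8100 := by
      have : |φ s + s * φ₁ s| ≤ 90 := by
        calc |φ s + s * φ₁ s| ≤ |φ s| + |s| * |φ₁ s| := by
              rw [← abs_mul]
              exact abs_add_le _ _
          _ ≤ 6 + 6 * R * (14 / R) := by
              rw [abs_of_nonneg h0]
              gcongr
          _ = 90 := by field_simp; norm_num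
      calc _ = |φ s + s * φ₁ s| ^ 2 := (sq_abs _).symm
        _ ≤ 90 ^ 2 := by gcongr
        _ = 8100 := by norm_num
    have hb2 : (3 * φ₂ s) ^ 2 ≤ 54 ^ 2 * 256 := by
      have : |φ₂ s| ≤ 18 * 16 := by
        refine h2.trans ?_
        rw [div_le_iff₀ (by positivity)]
        nlinarith
      calc _ = 9 * |φ₂ s| ^ 2 := by rw [sq_abs]; ring
        _ ≤ 9 * (18 * 16) ^ 2 := by gcongr
        _ = _ := by norm_num
    have hb3 : (9 * φ s * u s) ^ 2 ≤ 1 := by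
      have : |9 * φ s * u s| ≤ 1 := by
        rw [abs_mul, abs_of_nonneg (by positivity)]
        nlinarith [h.small s, abs_nonneg (u s)]
      calc _ = |9 * φ s * u s| ^ 2 := (sq_abs _).symm
        _ ≤ 1 ^ 2 := by gcongr
        _ = 1 := by norm_num
    have hb4 : φ s ^ 2 ≤ 36 := by nlinarith
    have := sq_add_four_le (-((φ s + s * φ₁ s) * (U s - m))) (-(3 * φ₂ s * u s)) (9 * φ s * u s * u s)
      (-(φ s * (f s - A)))
    calc W s ^ 2 = (-((φ s + s * φ₁ s) * (U s - m)) + -(3 * φ₂ s * u s) + 9 * φ s * u s * u s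
      + -(φ s * (f s - A))) ^ 2 := by simp only [W]; ring
      _ ≤ _ := this
      _ = 4 * ((φ s + s * φ₁ s) ^ 2 * (U s - m) ^ 2 + (3 * φ₂ s) ^ 2 * u s ^ 2
        + (9 * φ s * u s) ^ 2 * u s ^ 2 + φ s ^ 2 * (f s - A) ^ 2) := by ring
      _ ≤ 4 * (8100 * (U s - m) ^ 2 + 54 ^ 2 * 256 * u s ^ 2
        + 1 * u s ^ 2 + 36 * (f s - A) ^ 2) := by gcongr
      _ = _ := by ring
  have hIW := integral_le_of_le_linear_combination (hWc.pow 2) (by fun_prop) (by fun_prop)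
    (by fun_prop) continuous_const hPQ.le _ _ _ _ hW2
  have hCS := sq_integral_le_mul_integral_sq hWc hPQ.le
  rw [← hWint, hQP, mul_pow] at hCS
  have hDR : 0 ≤ D * R := by positivity
  have hED' : E * R ≤ D * R := by gcongr
  have hDr : D * r ^ 2 ≤ D * (4 * R) := by gcongr
  have hIW' : ∫ s in P..Q, W s ^ 2 ≤ 1.24 * 10 ^ 7 * (R * D) := by
    refine hIW.trans ?_
    simp only [zero_mul, add_zero]
    linarith
  have hA2 : A ^ 2 ≤ 2.4 * 10 ^ 6 * D := by
    have h1 : (4 * R) ^ 2 * A ^ 2 ≤ 3 * R * (1.24 * 10 ^ 7 * (R * D)) :=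
      calc (4 * R) ^ 2 * A ^ 2 ≤ (∫ s in P..Q, φ s) ^ 2 * A ^ 2 := by gcongr
        _ ≤ _ := hCS
        _ ≤ _ := by gcongr
    have h2 : 0 < R ^ 2 := by positivity
    refine le_of_mul_le_mul_left ?_ h2
    linarith [mul_nonneg h2.le hD]
  have hfp : ∀ s ∈ Icc P Q, f s ^ 2 ≤ 2 * (f s - A) ^ 2 + 2 * A ^ 2 * 1 + 0 * 0 + 0 * 0 := by
    intro s _
    nlinarith [sq_nonneg (f s - A - A)]
  have hIf := integral_le_of_le_linear_combination (hf.pow 2) (by fun_prop) continuous_const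
    continuous_const continuous_const hPQ.le _ _ _ _ hfp
  refine hIf.trans ?_
  simp only [zero_mul, add_zero, intervalIntegral.integral_const, smul_eq_mul, mul_one, hQP]
  linarith [mul_le_mul_of_nonneg_right hA2 hR.le]

theorem exists_energy_weight (h : IsSmallSolution E U u u₁ u₂ f) (x₀ : ℝ) {R : ℝ} (hR : 0 < R) :
    ∃ φ : ℝ → ℝ, Continuous φ ∧ (∀ s ∈ Icc (x₀ - 2 * R) (x₀ + R), 0 ≤ φ s ∧ φ s ≤ 6) ∧
      (∀ s ∈ Icc (x₀ - R) x₀, 4 ≤ φ s) ∧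
      ∫ s in (x₀ - 2 * R)..(x₀ + R), φ s * (3 * u₁ s ^ 2 + s * u s ^ 2 + 9 * u s ^ 3 - u s * f s)
        ≤ 27 / R ^ 2 * ∫ s in (x₀ - 2 * R)..(x₀ + R), u s ^ 2 := by
  have hu := h.continuous_u
  have hu₁ := h.continuous_u₁
  have hf := h.continuous_f
  obtain ⟨φ, φ₁, φ₂, hφ, hφ₁, hφ₂c, hφP, hφQ, hφ₁P, hφ₁Q, hφb, hφ4⟩ := exists_bump x₀ hR
  have hφc : Continuous φ := continuous_iff_continuousAt.2 fun x => (hφ x).continuousAt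
  refine ⟨φ, hφc, fun s hs => ⟨(hφb s hs).1, (hφb s hs).2.1⟩, hφ4, ?_⟩
  have hPQ : x₀ - 2 * R ≤ x₀ + R := by linarith
  have key : ∫ s in (x₀ - 2 * R)..(x₀ + R),
      (φ s * (3 * u₁ s ^ 2 + s * u s ^ 2 + 9 * u s ^ 3 - u s * f s) - 3 / 2 * φ₂ s * u s ^ 2)
      = 0 := by
    rw [intervalIntegral.integral_eq_sub_of_hasDerivAt
      (f := fun s => 3 * (φ s * (u s * u₁ s)) - 3 / 2 * (φ₁ s * u s ^ 2)) (fun s _ => ?_)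
      ((by fun_prop : Continuous _).intervalIntegrable _ _)]
    · rw [hφP, hφQ, hφ₁P, hφ₁Q]
      ring
    · refine ((((hφ s).fun_mul ((h.hasDerivAt_u s).fun_mul (h.hasDerivAt_u₁ s))).const_mul 3).fun_sub
        (((hφ₁ s).fun_mul ((h.hasDerivAt_u s).fun_pow 2)).const_mul (3 / 2))).congr_deriv ?_
      rw [h.eq s]
      norm_num
      ring
  rw [intervalIntegral.integral_sub ((by fun_prop : Continuous _).intervalIntegrable _ _)
    ((by fun_prop : Continuous _).intervalIntegrable _ _), sub_eq_zero] at key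
  rw [key, ← intervalIntegral.integral_const_mul]
  refine intervalIntegral.integral_mono_on hPQ ((by fun_prop : Continuous _).intervalIntegrable _ _)
    ((by fun_prop : Continuous _).intervalIntegrable _ _) fun s hs => ?_
  refine mul_le_mul_of_nonneg_right ?_ (sq_nonneg _)
  have h2 := (hφb s hs).2.2.2
  calc 3 / 2 * φ₂ s ≤ 3 / 2 * (18 / R ^ 2) := by linarith [le_abs_self (φ₂ s)]
    _ = 27 / R ^ 2 := by ring

theorem weighted_integral_le (h : IsSmallSolution E U u u₁ u₂ f) {x₀ R D c₁ c₂ K L : ℝ}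
    (hR : 0 < R) (hc₁ : 0 ≤ c₁) (hc₂ : 0 ≤ c₂) (hK : 0 ≤ K) (hL : 0 ≤ L)
    (hpt : ∀ s ∈ Icc (x₀ - 2 * R) (x₀ + R), c₁ * u₁ s ^ 2 + c₂ * u s ^ 2
      ≤ 3 * u₁ s ^ 2 + s * u s ^ 2 + 9 * u s ^ 3 - u s * f s + K * u s ^ 2 + L * f s ^ 2)
    (hb : (27 / R ^ 2 + 6 * K) * (∫ s in (x₀ - 2 * R)..(x₀ + R), u s ^ 2)
      + 6 * L * (∫ s in (x₀ - 2 * R)..(x₀ + R), f s ^ 2) ≤ D) :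
    4 * c₁ * (∫ s in (x₀ - R)..x₀, u₁ s ^ 2) + 4 * c₂ * (∫ s in (x₀ - R)..x₀, u s ^ 2) ≤ D := by
  have hu := h.continuous_u
  have hu₁ := h.continuous_u₁
  have hf := h.continuous_f
  obtain ⟨φ, hφc, hφ6, hφ4, hφ⟩ := h.exists_energy_weight x₀ hR
  have hPQ : x₀ - 2 * R ≤ x₀ + R := by linarith
  have h1 : 4 * c₁ * (∫ s in (x₀ - R)..x₀, u₁ s ^ 2) + 4 * c₂ * (∫ s in (x₀ - R)..x₀, u s ^ 2)
      ≤ ∫ s in (x₀ - R)..x₀, φ s * (c₁ * u₁ s ^ 2 + c₂ * u s ^ 2) := by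
    rw [← intervalIntegral.integral_const_mul, ← intervalIntegral.integral_const_mul,
      ← intervalIntegral.integral_add]
    · refine intervalIntegral.integral_mono_on (by linarith)
        ((by fun_prop : Continuous _).intervalIntegrable _ _)
        ((by fun_prop : Continuous _).intervalIntegrable _ _) fun s hs => ?_
      have := mul_le_mul_of_nonneg_right (hφ4 s hs)
        (by positivity : 0 ≤ c₁ * u₁ s ^ 2 + c₂ * u s ^ 2)
      linarith
    all_goals exact (by fun_prop : Continuous _).intervalIntegrable _ _
  have h2 : (∫ s in (x₀ - R)..x₀, φ s * (c₁ * u₁ s ^ 2 + c₂ * u s ^ 2))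
      ≤ ∫ s in (x₀ - 2 * R)..(x₀ + R), φ s * (c₁ * u₁ s ^ 2 + c₂ * u s ^ 2) := by
    refine intervalIntegral.integral_mono_interval (by linarith) (by linarith) (by linarith) ?_
      ((by fun_prop : Continuous _).intervalIntegrable _ _)
    filter_upwards [ae_restrict_mem measurableSet_Ioc] with s hs
    have := (hφ6 s ⟨hs.1.le, hs.2⟩).1
    simp only [Pi.zero_apply]
    positivity
  have h3 := integral_le_of_le_linear_combination
    (F := fun s => φ s * (c₁ * u₁ s ^ 2 + c₂ * u s ^ 2))
    (g₁ := fun s => φ s * (3 * u₁ s ^ 2 + s * u s ^ 2 + 9 * u s ^ 3 - u s * f s))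
    (g₂ := fun s => u s ^ 2) (g₃ := fun s => f s ^ 2) (g₄ := fun _ => 0)
    (by fun_prop) (by fun_prop) (by fun_prop) (by fun_prop) continuous_const hPQ 1 (6 * K) (6 * L) 0
    (fun s hs => by
      obtain ⟨h0, h6⟩ := hφ6 s hs
      have e1 := mul_le_mul_of_nonneg_left (hpt s hs) h0
      have e2 := mul_le_mul_of_nonneg_right h6 (by positivity : 0 ≤ K * u s ^ 2 + L * f s ^ 2)
      linarith)
  linarith

theorem abs_cube_le (h : IsSmallSolution E U u u₁ u₂ f) (s : ℝ) :
    |u s ^ 3| ≤ 1 / 144 * u s ^ 2 := by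
  rw [abs_pow, ← sq_abs (u s)]
  nlinarith [h.small s, sq_nonneg |u s|]

theorem integral_deriv_sq_le (h : IsSmallSolution E U u u₁ u₂ f) {x₀ r D : ℝ} (hr : 1 ≤ r)
    (hx₀ : |x₀| ≤ r ^ 4) (hD : 0 ≤ D)
    (hu2 : ∫ s in (x₀ - 2 * (r ^ 4 / 4))..(x₀ + r ^ 4 / 4), u s ^ 2 ≤ D * r ^ 2)
    (hf2 : ∫ s in (x₀ - 2 * (r ^ 4 / 4))..(x₀ + r ^ 4 / 4), f s ^ 2 ≤ D * r ^ 4) :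
    ∫ s in (x₀ - r ^ 4 / 4)..x₀, u₁ s ^ 2 ≤ 40 * D * r ^ 6 := by
  have hr0 : 0 < r := by linarith
  have hr4 : 1 ≤ r ^ 4 := one_le_pow₀ hr
  have hr6 : 1 ≤ r ^ 6 := one_le_pow₀ hr
  have := h.weighted_integral_le (x₀ := x₀) (R := r ^ 4 / 4) (c₁ := 3) (c₂ := 0)
    (K := 3 * r ^ 4) (L := 1 / r ^ 4) (D := 480 * D * r ^ 6) (by positivity) (by norm_num) le_rfl
    (by positivity) (by positivity) (fun s hs => ?_) ?_
  · linarith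
  · have h1 := h.abs_cube_le s
    have hs' : -s ≤ 3 / 2 * r ^ 4 := by linarith [hs.1, (abs_le.1 hx₀).1]
    have h2 : u s * f s ≤ r ^ 4 * u s ^ 2 + 1 / r ^ 4 * f s ^ 2 := by
      have e : r ^ 4 * u s ^ 2 + 1 / r ^ 4 * f s ^ 2 - u s * f s
          = 3 / 4 * r ^ 4 * u s ^ 2 + 1 / r ^ 4 * (f s - r ^ 4 * u s / 2) ^ 2 := by
        field_simp
        ring
      linarith [(by positivity : 0 ≤ 3 / 4 * r ^ 4 * u s ^ 2 + 1 / r ^ 4 * (f s - r ^ 4 * u s / 2) ^ 2)]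
    have h3 := mul_le_mul_of_nonneg_right hs' (sq_nonneg (u s))
    have h4 := mul_le_mul_of_nonneg_right hr4 (sq_nonneg (u s))
    linarith [neg_abs_le (u s ^ 3), sq_nonneg (u s)]
  · have h1 : 27 / (r ^ 4 / 4) ^ 2 ≤ 432 * r ^ 4 := by
      rw [div_le_iff₀ (by positivity)]
      nlinarith [one_le_pow₀ hr (n := 12)]
    calc _ ≤ (432 * r ^ 4 + 6 * (3 * r ^ 4)) * (D * r ^ 2) + 6 * (1 / r ^ 4) * (D * r ^ 4) := by
          gcongr
          exact intervalIntegral.integral_nonneg (by linarith) fun _ _ => sq_nonneg _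
      _ = 450 * D * r ^ 6 + 6 * D := by field_simp; ring
      _ ≤ _ := by nlinarith [mul_le_mul_of_nonneg_left hr6 hD]

theorem integral_sq_le_of_pos (h : IsSmallSolution E U u u₁ u₂ f) {x₀ r D : ℝ} (hr : 1 ≤ r)
    (hx₀ : 3 / 4 * r ^ 4 ≤ x₀) (hD : 0 ≤ D)
    (hu2 : ∫ s in (x₀ - 2 * (r ^ 4 / 4))..(x₀ + r ^ 4 / 4), u s ^ 2 ≤ D * r ^ 2)
    (hf2 : ∫ s in (x₀ - 2 * (r ^ 4 / 4))..(x₀ + r ^ 4 / 4), f s ^ 2 ≤ D * r ^ 4) :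
    12 * (∫ s in (x₀ - r ^ 4 / 4)..x₀, u₁ s ^ 2)
      + r ^ 4 / 4 * (∫ s in (x₀ - r ^ 4 / 4)..x₀, u s ^ 2) ≤ 500 * D := by
  have hr0 : 0 < r := by linarith
  have hr4 : 1 ≤ r ^ 4 := one_le_pow₀ hr
  have hr6 : 1 ≤ r ^ 6 := one_le_pow₀ hr
  have := h.weighted_integral_le (x₀ := x₀) (R := r ^ 4 / 4) (c₁ := 3) (c₂ := r ^ 4 / 16)
    (K := 0) (L := 4 / r ^ 4) (D := 500 * D) (by positivity) (by norm_num) (by positivity)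
    le_rfl (by positivity) (fun s hs => ?_) ?_
  · linarith
  · have h1 := h.abs_cube_le s
    have hs' : 1 / 4 * r ^ 4 ≤ s := by linarith [hs.1]
    have h2 : u s * f s ≤ r ^ 4 / 16 * u s ^ 2 + 4 / r ^ 4 * f s ^ 2 := by
      have e : r ^ 4 / 16 * u s ^ 2 + 4 / r ^ 4 * f s ^ 2 - u s * f s
          = 4 / r ^ 4 * (f s - r ^ 4 * u s / 8) ^ 2 := by
        field_simp
        ring
      linarith [(by positivity : 0 ≤ 4 / r ^ 4 * (f s - r ^ 4 * u s / 8) ^ 2)]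
    have h3 := mul_le_mul_of_nonneg_right hs' (sq_nonneg (u s))
    have h4 := mul_le_mul_of_nonneg_right hr4 (sq_nonneg (u s))
    linarith [neg_abs_le (u s ^ 3), sq_nonneg (u s)]
  · calc _ ≤ (27 / (r ^ 4 / 4) ^ 2 + 6 * 0) * (D * r ^ 2) + 6 * (4 / r ^ 4) * (D * r ^ 4) := by
          gcongr
      _ = 432 * D / r ^ 6 + 24 * D := by field_simp; ring
      _ ≤ 432 * D + 24 * D := by gcongr; exact div_le_self (by positivity) hr6
      _ ≤ _ := by linarith

theorem sq_le_of_neg_le (h : IsSmallSolution E U u u₁ u₂ f) {x₀ r D : ℝ} (hr : 1 ≤ r)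
    (hx₀ : x₀ ^ 2 + 1 = r ^ 8) (hx₀' : -(3 / 4 * r ^ 4) ≤ x₀) (hD : 0 ≤ D)
    (hu2 : ∫ s in (x₀ - 2 * (r ^ 4 / 4))..(x₀ + r ^ 4 / 4), u s ^ 2 ≤ D * r ^ 2)
    (hf2 : ∫ s in (x₀ - 2 * (r ^ 4 / 4))..(x₀ + r ^ 4 / 4), f s ^ 2 ≤ D * r ^ 4)
    (hu12 : ∫ s in (x₀ - r ^ 4 / 4)..x₀, u₁ s ^ 2 ≤ 40 * D * r ^ 6) :
    r ^ 2 * u x₀ ^ 2 ≤ 10100 * D := by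
  have hr0 : 0 < r := by linarith
  have hu := h.continuous_u
  have hr4 : 1 ≤ r ^ 4 := one_le_pow₀ hr
  have hr2 : 1 ≤ r ^ 2 := one_le_pow₀ hr
  have hS := sq_apply_le_integral_sq h.hasDerivAt_u h.continuous_u₁ x₀
    (by positivity : 0 < r ^ 4 / 4) (by positivity : 0 < r ^ 2)
  have hI0 : 0 ≤ ∫ s in (x₀ - r ^ 4 / 4)..x₀, u s ^ 2 :=
    intervalIntegral.integral_nonneg (by linarith) fun _ _ => sq_nonneg _
  have hS' : u x₀ ^ 2 ≤ 5 * r ^ 2 * (∫ s in (x₀ - r ^ 4 / 4)..x₀, u s ^ 2)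
      + (r ^ 2)⁻¹ * ∫ s in (x₀ - r ^ 4 / 4)..x₀, u₁ s ^ 2 := by
    refine hS.trans ?_
    gcongr
    have : (r ^ 4 / 4)⁻¹ ≤ 4 := by
      rw [inv_div]
      exact div_le_self (by norm_num) hr4
    linarith
  have hS'' : r ^ 2 * u x₀ ^ 2 ≤ 5 * r ^ 4 * (∫ s in (x₀ - r ^ 4 / 4)..x₀, u s ^ 2)
      + ∫ s in (x₀ - r ^ 4 / 4)..x₀, u₁ s ^ 2 := by
    refine (mul_le_mul_of_nonneg_left hS' (by positivity)).trans (le_of_eq ?_)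
    field_simp
  rcases le_total (3 / 4 * r ^ 4) x₀ with hpos | hmid
  · have h1 := h.integral_sq_le_of_pos hr hpos hD hu2 hf2
    have h2 : 0 ≤ ∫ s in (x₀ - r ^ 4 / 4)..x₀, u₁ s ^ 2 :=
      intervalIntegral.integral_nonneg (by linarith) fun _ _ => sq_nonneg _
    linarith
  · have h1 : r ^ 8 ≤ 16 / 7 := by nlinarith
    have h2 : r ^ 4 ≤ 2 := by nlinarith
    have h24 : r ^ 2 ≤ r ^ 4 := pow_le_pow_right₀ hr (by norm_num)
    have h3 : r ^ 6 ≤ 4 := by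
      calc r ^ 6 = r ^ 4 * r ^ 2 := by ring
        _ ≤ 2 * 2 := by
          gcongr
          exact h24.trans h2
        _ = 4 := by norm_num
    have h4 : (∫ s in (x₀ - r ^ 4 / 4)..x₀, u s ^ 2)
        ≤ ∫ s in (x₀ - 2 * (r ^ 4 / 4))..(x₀ + r ^ 4 / 4), u s ^ 2 := by
      refine intervalIntegral.integral_mono_interval (by linarith) (by linarith) (by linarith) ?_
        ((by fun_prop : Continuous _).intervalIntegrable _ _)
      exact Filter.Eventually.of_forall fun s => sq_nonneg _
    calc _ ≤ _ := hS''
      _ ≤ 5 * r ^ 4 * (D * r ^ 2) + 40 * D * r ^ 6 := by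
        gcongr
        exact h4.trans hu2
      _ = 45 * D * r ^ 6 := by ring
      _ ≤ 45 * D * 4 := by gcongr
      _ ≤ _ := by linarith

theorem abs_two_mul_mul_le (v k : ℝ) {b : ℝ} (hb : 0 < b) :
    |2 * v * k| ≤ b * v ^ 2 + 1 / b * k ^ 2 := by
  have e1 : b * v ^ 2 + 1 / b * k ^ 2 - 2 * v * k = 1 / b * (b * v - k) ^ 2 := by field_simp; ring
  have e2 : b * v ^ 2 + 1 / b * k ^ 2 + 2 * v * k = 1 / b * (b * v + k) ^ 2 := by field_simp; ring
  rw [abs_le]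
  constructor
  · linarith [(by positivity : 0 ≤ 1 / b * (b * v + k) ^ 2)]
  · linarith [(by positivity : 0 ≤ 1 / b * (b * v - k) ^ 2)]

theorem abs_energy_deriv_le {b s ψ v v₁ d k k₁ : ℝ} (hb : 1 ≤ b) (hs : |s| ≤ 5 / 4 * b)
    (hψ₀ : 0 ≤ ψ) (hψ : ψ ≤ b / 4) (hv : |v ^ 3| ≤ 1 / 144 * v ^ 2) :
    |(3 * v₁ ^ 2 - s * v ^ 2 - 6 * v ^ 3) - 2 * ψ * v₁ * d - ψ * v ^ 2 + 2 * v * k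
      + 2 * ψ * v * k₁|
      ≤ (4 * v₁ ^ 2 + 4 * b * v ^ 2) + b ^ 2 / 16 * d ^ 2 + 1 / b * k ^ 2 + b / 4 * k₁ ^ 2 := by
  have h1 : |s * v ^ 2| ≤ 5 / 4 * b * v ^ 2 := by
    rw [abs_mul, abs_of_nonneg (sq_nonneg v)]
    gcongr
  have h2 : |2 * v₁ * (ψ * d)| ≤ v₁ ^ 2 + b ^ 2 / 16 * d ^ 2 := by
    have e1 := abs_two_mul_mul_le v₁ (ψ * d) one_pos
    have e2 : (ψ * d) ^ 2 ≤ (b / 4) ^ 2 * d ^ 2 := by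
      rw [mul_pow]
      gcongr
    linarith
  have h3 : |ψ * v ^ 2| ≤ b / 4 * v ^ 2 := by
    rw [abs_of_nonneg (by positivity)]
    gcongr
  have h4 := abs_two_mul_mul_le v k (by linarith : 0 < b)
  have h5 : |ψ * (2 * v * k₁)| ≤ b / 4 * (v ^ 2 + k₁ ^ 2) := by
    have e1 := abs_two_mul_mul_le v k₁ one_pos
    rw [abs_mul, abs_of_nonneg hψ₀]
    calc _ ≤ b / 4 * |2 * v * k₁| := by gcongr
      _ ≤ _ := by gcongr; linarith
  have h6 := mul_le_mul_of_nonneg_right hb (sq_nonneg v)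
  have h7 := sq_nonneg v₁
  have h8 := sq_nonneg v
  rw [abs_le] at h1 h2 h3 h4 h5 hv ⊢
  constructor <;> linarith

theorem exists_energy_le (h : IsSmallSolution E U u u₁ u₂ f) {x₀ r D : ℝ} (hr : 1 ≤ r)
    (hx₀ : |x₀| ≤ r ^ 4) (hD : 0 ≤ D) (hED : E ≤ D)
    (hu2 : ∫ s in (x₀ - r ^ 4 / 4)..x₀, u s ^ 2 ≤ D * r ^ 2)
    (hf2 : ∫ s in (x₀ - r ^ 4 / 4)..x₀, f s ^ 2 ≤ D * r ^ 4)
    (hu12 : ∫ s in (x₀ - r ^ 4 / 4)..x₀, u₁ s ^ 2 ≤ 40 * D * r ^ 6) :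
    ∃ m : ℝ, m ^ 2 ≤ 21 * D * r ^ 6 ∧
      |3 * u₁ x₀ ^ 2 - x₀ * u x₀ ^ 2 - 6 * u x₀ ^ 3 + 2 * u x₀ * m| ≤ 680 * D * r ^ 2 := by
  have hr0 : 0 < r := by linarith
  have hr4 : 1 ≤ r ^ 4 := one_le_pow₀ hr
  have hr6 : 1 ≤ r ^ 6 := one_le_pow₀ hr
  have hu := h.continuous_u
  have hu₁ := h.continuous_u₁
  have hf := h.continuous_f
  obtain ⟨k, k₁, hk, hk₁, hkE⟩ := h.shift_f.exists_approx hf (by positivity : 0 < (r ^ 2)⁻¹)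
  have hkc : Continuous k := continuous_iff_continuousAt.2 fun x => (hk x).continuousAt
  have hPQ : x₀ - r ^ 4 / 4 ≤ x₀ := by linarith
  obtain ⟨hfk, hk1⟩ := hkE _ _ hPQ
  have hfk' : ∫ s in (x₀ - r ^ 4 / 4)..x₀, (f s - k s) ^ 2 ≤ D / r ^ 2 := by
    refine hfk.trans ?_
    rw [inv_mul_eq_div]
    gcongr
  have hk1' : ∫ s in (x₀ - r ^ 4 / 4)..x₀, k₁ s ^ 2 ≤ D * r ^ 2 := by
    refine hk1.trans ?_
    rw [inv_inv, mul_comm]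
    gcongr
  have hk2 : ∫ s in (x₀ - r ^ 4 / 4)..x₀, k s ^ 2 ≤ 4 * D * r ^ 4 := by
    have h1 := integral_le_of_le_linear_combination (F := fun s => k s ^ 2)
      (g₁ := fun s => f s ^ 2) (g₂ := fun s => (f s - k s) ^ 2) (g₃ := fun _ => 0)
      (g₄ := fun _ => 0) (by fun_prop) (by fun_prop) (by fun_prop) (by fun_prop) (by fun_prop)
      hPQ 2 2 0 0 (fun s _ => by linarith [sq_nonneg (2 * f s - k s)])
    have h2 : D / r ^ 2 ≤ D * r ^ 4 :=
      (div_le_self hD (one_le_pow₀ hr)).trans (le_mul_of_one_le_right hD hr4)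
    linarith
  refine ⟨k x₀, ?_, ?_⟩
  · have hS := sq_apply_le_integral_sq hk hk₁ x₀ (by positivity : 0 < r ^ 4 / 4)
      (by positivity : 0 < (r ^ 4)⁻¹)
    calc k x₀ ^ 2 ≤ _ := hS
      _ ≤ ((r ^ 4 / 4)⁻¹ + (r ^ 4)⁻¹) * (4 * D * r ^ 4) + ((r ^ 4)⁻¹)⁻¹ * (D * r ^ 2) := by gcongr
      _ = 20 * D + D * r ^ 6 := by field_simp; ring
      _ ≤ 21 * D * r ^ 6 := by nlinarith [mul_le_mul_of_nonneg_left hr6 hD]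
  · set e : ℝ → ℝ := fun s => (3 * u₁ s ^ 2 - s * u s ^ 2 - 6 * u s ^ 3)
      - 2 * (s - (x₀ - r ^ 4 / 4)) * u₁ s * (f s - k s) - (s - (x₀ - r ^ 4 / 4)) * u s ^ 2
      + 2 * u s * k s + 2 * (s - (x₀ - r ^ 4 / 4)) * u s * k₁ s with he
    have hec : Continuous e := by fun_prop
    have key : ∫ s in (x₀ - r ^ 4 / 4)..x₀, e s
        = r ^ 4 / 4 * (3 * u₁ x₀ ^ 2 - x₀ * u x₀ ^ 2 - 6 * u x₀ ^ 3 + 2 * u x₀ * k x₀) := by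
      rw [intervalIntegral.integral_eq_sub_of_hasDerivAt
        (f := fun s => (s - (x₀ - r ^ 4 / 4))
          * (3 * u₁ s ^ 2 - s * u s ^ 2 - 6 * u s ^ 3 + 2 * (u s * k s))) (fun s _ => ?_)
        (hec.intervalIntegrable _ _)]
      · ring
      · have d1 := h.hasDerivAt_u s
        have d2 := h.hasDerivAt_u₁ s
        refine (((hasDerivAt_id s).sub_const (x₀ - r ^ 4 / 4)).fun_mul
          (((((d2.fun_pow 2).const_mul 3).fun_sub ((hasDerivAt_id s).fun_mul (d1.fun_pow 2))).fun_sub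
          ((d1.fun_pow 3).const_mul 6)).fun_add ((d1.fun_mul (hk s)).const_mul 2))).congr_deriv ?_
        simp only [he, id, h.eq s]
        norm_num
        ring
    have hbound : ∫ s in (x₀ - r ^ 4 / 4)..x₀, |e s| ≤ 170 * D * r ^ 6 := by
      have h1 := integral_le_of_le_linear_combination (F := fun s => |e s|)
        (g₁ := fun s => 4 * u₁ s ^ 2 + 4 * r ^ 4 * u s ^ 2) (g₂ := fun s => (f s - k s) ^ 2)
        (g₃ := fun s => k s ^ 2) (g₄ := fun s => k₁ s ^ 2)
        (by fun_prop) (by fun_prop) (by fun_prop) (by fun_prop) (by fun_prop)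
        hPQ 1 (r ^ 8 / 16) (1 / r ^ 4) (r ^ 4 / 4) (fun s hs => ?_)
      · rw [intervalIntegral.integral_add
          ((by fun_prop : Continuous _).intervalIntegrable _ _)
          ((by fun_prop : Continuous _).intervalIntegrable _ _),
          intervalIntegral.integral_const_mul, intervalIntegral.integral_const_mul] at h1
        calc _ ≤ _ := h1
          _ ≤ 1 * (4 * (40 * D * r ^ 6) + 4 * r ^ 4 * (D * r ^ 2)) + r ^ 8 / 16 * (D / r ^ 2)
              + 1 / r ^ 4 * (4 * D * r ^ 4) + r ^ 4 / 4 * (D * r ^ 2) := by gcongr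
          _ = (164 + 1 / 16 + 1 / 4) * D * r ^ 6 + 4 * D := by field_simp; ring
          _ ≤ _ := by nlinarith [mul_le_mul_of_nonneg_left hr6 hD]
      · have hs' : |s| ≤ 5 / 4 * r ^ 4 := by
          rw [abs_le] at hx₀ ⊢
          constructor <;> linarith [hs.1, hs.2]
        have := abs_energy_deriv_le (v₁ := u₁ s) (d := f s - k s) (k := k s) (k₁ := k₁ s) hr4 hs'
          (sub_nonneg.2 hs.1) (by linarith [hs.2]) (h.abs_cube_le s)
        refine this.trans (le_of_eq ?_)
        ring
    have hR : 0 < r ^ 4 / 4 := by positivity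
    refine le_of_mul_le_mul_left ?_ hR
    rw [← abs_of_pos hR, ← abs_mul, abs_of_pos hR, ← key]
    calc _ ≤ _ := intervalIntegral.abs_integral_le_integral_abs hPQ
      _ ≤ _ := hbound
      _ = _ := by ring

theorem sq_add_sq_le (h : IsSmallSolution E U u u₁ u₂ f) {x₀ r D : ℝ} (hr : 1 ≤ r)
    (hx₀ : x₀ ^ 2 + 1 = r ^ 8) (hD : 0 ≤ D) (hED : E ≤ D)
    (hu2 : ∫ s in (x₀ - 2 * (r ^ 4 / 4))..(x₀ + r ^ 4 / 4), u s ^ 2 ≤ D * r ^ 2)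
    (hf2 : ∫ s in (x₀ - 2 * (r ^ 4 / 4))..(x₀ + r ^ 4 / 4), f s ^ 2 ≤ D * r ^ 4) :
    r ^ 2 * u x₀ ^ 2 + u₁ x₀ ^ 2 / r ^ 2 ≤ 30000 * D := by
  have hr0 : 0 < r := by linarith
  have hr4 : 1 ≤ r ^ 4 := one_le_pow₀ hr
  have hu := h.continuous_u
  have hf := h.continuous_f
  have hx : |x₀| ≤ r ^ 4 := abs_le_of_sq_le_sq (by nlinarith) (by positivity)
  have hu12 := h.integral_deriv_sq_le hr hx hD hu2 hf2
  have sub : ∀ g : ℝ → ℝ, Continuous g → ∫ s in (x₀ - r ^ 4 / 4)..x₀, g s ^ 2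
      ≤ ∫ s in (x₀ - 2 * (r ^ 4 / 4))..(x₀ + r ^ 4 / 4), g s ^ 2 := fun g hg =>
    intervalIntegral.integral_mono_interval (by linarith) (by linarith) (by linarith)
      (Filter.Eventually.of_forall fun s => sq_nonneg _)
      ((by fun_prop : Continuous _).intervalIntegrable _ _)
  obtain ⟨m, hm, hen⟩ := h.exists_energy_le hr hx hD hED ((sub u hu).trans hu2)
    ((sub f hf).trans hf2) hu12
  have hcube := h.abs_cube_le x₀
  have hum : |2 * u x₀ * m| ≤ r ^ 4 / 4 * u x₀ ^ 2 + 84 * D * r ^ 2 := by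
    have e3 : 4 / r ^ 4 * m ^ 2 ≤ 84 * D * r ^ 2 := by
      calc 4 / r ^ 4 * m ^ 2 ≤ 4 / r ^ 4 * (21 * D * r ^ 6) := by gcongr
        _ = _ := by field_simp; ring
    have e1 := abs_two_mul_mul_le (u x₀) m (by positivity : 0 < r ^ 4 / 4)
    rw [one_div_div] at e1
    linarith
  rw [abs_le] at hen hcube hum
  have hsq := sq_nonneg (u x₀)
  have hsq₁ := sq_nonneg (u₁ x₀)
  have a7 := mul_le_mul_of_nonneg_right hr4 hsq
  have hDr : 0 ≤ D * r ^ 2 := by positivity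
  suffices H : r ^ 2 * u x₀ ^ 2 ≤ 10100 * D ∧ u₁ x₀ ^ 2 ≤ 15000 * (D * r ^ 2) by
    have : u₁ x₀ ^ 2 / r ^ 2 ≤ 15000 * D := by
      rw [div_le_iff₀ (by positivity)]
      linarith [H.2]
    linarith [H.1]
  rcases le_total x₀ (-(3 / 4 * r ^ 4)) with hneg | hmid
  · have h1 := mul_le_mul_of_nonneg_right hneg hsq
    have h2 : r ^ 4 / 4 * u x₀ ^ 2 + 3 * u₁ x₀ ^ 2 ≤ 764 * (D * r ^ 2) := by linarith
    refine ⟨?_, by nlinarith⟩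
    have h3 : r ^ 2 * (r ^ 2 * u x₀ ^ 2) ≤ r ^ 2 * (3056 * D) := by nlinarith
    linarith [le_of_mul_le_mul_left h3 (by positivity)]
  · have h1 := h.sq_le_of_neg_le hr hx₀ hmid hD hu2 hf2 hu12
    refine ⟨h1, ?_⟩
    have h2 := mul_le_mul_of_nonneg_right (abs_le.1 hx).2 hsq
    have h3 : r ^ 4 * u x₀ ^ 2 ≤ 10100 * (D * r ^ 2) := by
      nlinarith [mul_le_mul_of_nonneg_left h1 (sq_nonneg r)]
    linarith

theorem sq_add_sq_le_of_bound (h : IsSmallSolution E U u u₁ u₂ f) {ρ : ℝ → ℝ} (hρ : ∀ x, 1 ≤ ρ x)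
    (hρ8 : ∀ x, x ^ 2 + 1 = ρ x ^ 8) {X : ℝ}
    (hX : ∀ x, ρ x ^ 2 * u x ^ 2 + u₁ x ^ 2 / ρ x ^ 2 ≤ X) (x : ℝ) :
    ρ x ^ 2 * u x ^ 2 + u₁ x ^ 2 / ρ x ^ 2 ≤ 10 ^ 19 / 2 * E + X / 2 := by
  have hE := h.shift_U.nonneg
  have hρ0 : ∀ x, 0 < ρ x := fun x => one_pos.trans_le (hρ x)
  have hX0 : 0 ≤ X := le_trans (by have := hρ0 0; positivity) (hX 0)
  have hx : |x| ≤ ρ x ^ 4 :=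
    abs_le_of_sq_le_sq (by nlinarith [hρ8 x]) (by have := hρ0 x; positivity)
  have hY : ∀ s, |s - x| ≤ ρ x ^ 4 / 2 → |u₁ s| ≤ 2 * √X * ρ x := by
    intro s hs
    have hs' : |s| ≤ 3 / 2 * ρ x ^ 4 := by
      have := abs_sub_abs_le_abs_sub s x
      linarith
    have h1 : ρ s ≤ 2 * ρ x := by
      refine le_of_pow_le_pow_left₀ (n := 8) (by norm_num) (by have := hρ0 x; positivity) ?_
      have h2 : s ^ 2 ≤ (3 / 2 * ρ x ^ 4) ^ 2 := by
        rw [← sq_abs s]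
        gcongr
      have h3 : 1 ≤ ρ x ^ 8 := one_le_pow₀ (hρ x)
      rw [← hρ8 s]
      linarith
    refine abs_le_of_sq_le_sq ?_ (by have := hρ0 x; positivity)
    have h2 : u₁ s ^ 2 / ρ s ^ 2 ≤ X :=
      le_trans (le_add_of_nonneg_left (by positivity)) (hX s)
    rw [div_le_iff₀ (by have := hρ0 s; positivity)] at h2
    calc u₁ s ^ 2 ≤ X * ρ s ^ 2 := h2
      _ ≤ X * (2 * ρ x) ^ 2 := by
        have := (hρ0 s).le
        gcongr
      _ = _ := by rw [mul_pow, mul_pow, mul_pow, sq_sqrt hX0]; ring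
  have h1 := h.integral_sq_le (hρ x) (by norm_num : (0 : ℝ) < 1 / 10 ^ 7) (by norm_num) hY
  rw [mul_pow, sq_sqrt hX0] at h1
  set D := 2 * (E / (1 / 10 ^ 7) + (1 / 10 ^ 7) ^ 2 * (2 ^ 2 * X)) with hD
  have hED : E ≤ D := by
    rw [hD, div_div_eq_mul_div, div_one]
    nlinarith
  have hD0 : 0 ≤ D := hE.trans hED
  have h2 := h.integral_source_sq_le (hρ x) hx hED h1
  have h3 := h.sq_add_sq_le (hρ x) (hρ8 x) (by positivity : 0 ≤ 4 * 10 ^ 6 * D) (by linarith)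
    (h1.trans (by
      have := hρ0 x
      gcongr
      linarith)) h2
  refine h3.trans ?_
  rw [hD, div_div_eq_mul_div, div_one]
  linarith

theorem weighted_sq_le (h : IsSmallSolution E U u u₁ u₂ f) {ρ : ℝ → ℝ} (hρ : ∀ x, 1 ≤ ρ x)
    (hρ8 : ∀ x, x ^ 2 + 1 = ρ x ^ 8) {X : ℝ}
    (hX : ∀ x, ρ x ^ 2 * u x ^ 2 + u₁ x ^ 2 / ρ x ^ 2 ≤ X) (x : ℝ) :
    ρ x ^ 2 * u x ^ 2 + u₁ x ^ 2 / ρ x ^ 2 ≤ 10 ^ 19 * E := by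
  have hbdd : BddAbove (range fun x => ρ x ^ 2 * u x ^ 2 + u₁ x ^ 2 / ρ x ^ 2) := by
    refine ⟨X, ?_⟩
    rintro _ ⟨x, rfl⟩
    exact hX x
  have h1 := ciSup_le fun x => h.sq_add_sq_le_of_bound hρ hρ8 (fun x => le_ciSup hbdd x) x
  have h2 := le_ciSup hbdd x
  linarith

end IsSmallSolution

/-- A real Schwartz function, viewed as a complex one. -/
def complexify (f : 𝓢(ℝ, ℝ)) : 𝓢(ℝ, ℂ) := f.postcompCLM Complex.ofRealCLM

theorem complexify_apply (f : 𝓢(ℝ, ℝ)) (x : ℝ) : complexify f x = f x := rfl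

theorem FT_eq_fourier (f : 𝓢(ℝ, ℝ)) : FT f = 𝓕 (complexify f) := rfl

theorem fourier_shift_sub (G : 𝓢(ℝ, ℂ)) (a ξ : ℝ) :
    𝓕 (compSubConstCLM ℂ (-a) G - G) ξ
      = (Complex.exp (Complex.I * (2 * π * a * ξ : ℝ)) - 1) * 𝓕 G ξ := by
  rw [sub_eq_add_neg, FourierAdd.fourier_add, FourierTransform.fourier_neg, ← sub_eq_add_neg,
    sub_apply]
  have h : 𝓕 (compSubConstCLM ℂ (-a) G) ξ
      = Complex.exp (Complex.I * (2 * π * a * ξ : ℝ)) * 𝓕 G ξ := by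
    have h1 := congrFun (VectorFourier.fourierIntegral_comp_add_right Real.fourierChar volume
      (innerₗ ℝ) (G : ℝ → ℂ) a) ξ
    have h2 : (compSubConstCLM ℂ (-a) G : ℝ → ℂ) = (G : ℝ → ℂ) ∘ fun v => v + a := by
      ext x
      simp
    rw [fourier_coe, fourier_coe, h2]
    refine h1.trans ?_
    rw [Circle.smul_def, Real.fourierChar_apply, smul_eq_mul]
    congr 2
    simp
    ring
  rw [h]
  ring

theorem norm_exp_sub_one_le_two (θ : ℝ) : ‖Complex.exp (Complex.I * θ) - 1‖ ≤ 2 := by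
  refine (norm_sub_le _ _).trans ?_
  rw [mul_comm, Complex.norm_exp_ofReal_mul_I]
  norm_num

theorem norm_exp_sub_one_sq_le (θ : ℝ) : ‖Complex.exp (Complex.I * θ) - 1‖ ^ 2 ≤ 2 * |θ| := by
  rw [sq]
  exact mul_le_mul (norm_exp_sub_one_le_two θ) (Real.norm_exp_I_mul_ofReal_sub_one_le)
    (norm_nonneg _) (by norm_num)

theorem integrable_norm_sq (G : 𝓢(ℝ, ℂ)) : Integrable fun ξ => ‖G ξ‖ ^ 2 :=
  (G.memLp 2).integrable_norm_pow (by norm_num)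

theorem integrable_abs_mul_norm_sq (G : 𝓢(ℝ, ℂ)) : Integrable fun ξ => |ξ| * ‖G ξ‖ ^ 2 := by
  obtain ⟨B, hB⟩ := G.decay 0 0
  refine ((G.integrable_pow_mul volume 1).bdd_mul (c := B) (f := fun ξ => ‖G ξ‖)
    G.continuous.norm.aestronglyMeasurable (Filter.Eventually.of_forall fun ξ => ?_)).congr
    (Filter.Eventually.of_forall fun ξ => ?_)
  · simpa using hB.2 ξ
  · simp only [pow_one, Real.norm_eq_abs]
    ring

theorem integral_sq_le_integral_fourier (g : 𝓢(ℝ, ℝ)) {p q : ℝ} (hpq : p ≤ q) :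
    ∫ s in p..q, g s ^ 2 ≤ ∫ ξ, ‖𝓕 (complexify g) ξ‖ ^ 2 := by
  rw [integral_norm_sq_fourier, intervalIntegral.integral_of_le hpq]
  have h : (fun s => g s ^ 2) = fun s => ‖complexify g s‖ ^ 2 := by
    ext s
    rw [complexify_apply, Complex.norm_real, Real.norm_eq_abs, sq_abs]
  rw [h]
  exact setIntegral_le_integral (integrable_norm_sq _)
    (Filter.Eventually.of_forall fun _ => sq_nonneg _)

theorem shiftBound_of_hsNorm_le (f : 𝓢(ℝ, ℝ)) {ε : ℝ} (hε : 0 ≤ ε)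
    (h : HsNorm ((1:ℝ)/2) f ≤ ε) : ShiftBound (4 * π * ε ^ 2) f := by
  intro a ha p q hpq
  set G := complexify f
  have hI : ∫ ξ, |ξ| * ‖𝓕 G ξ‖ ^ 2 ≤ ε ^ 2 := by
    have h1 : HsNorm ((1:ℝ)/2) f = √(∫ ξ, |ξ| * ‖𝓕 G ξ‖ ^ 2) := by
      rw [HsNorm, Real.sqrt_eq_rpow, FT_eq_fourier]
      norm_num
      rfl
    rw [h1, Real.sqrt_le_left hε] at h
    exact h
  have h2 := integral_sq_le_integral_fourier (compSubConstCLM ℝ (-a) f - f) hpq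
  have h3 : complexify (compSubConstCLM ℝ (-a) f - f) = compSubConstCLM ℂ (-a) G - G := by
    ext x
    simp [complexify_apply, G]
  rw [h3] at h2
  calc ∫ s in p..q, (f (s + a) - f s) ^ 2
      = ∫ s in p..q, (compSubConstCLM ℝ (-a) f - f) s ^ 2 := by simp
    _ ≤ _ := h2
    _ ≤ ∫ ξ, 4 * π * a * (|ξ| * ‖𝓕 G ξ‖ ^ 2) := by
      refine integral_mono (integrable_norm_sq (𝓕 (compSubConstCLM ℂ (-a) G - G)))
        ((integrable_abs_mul_norm_sq (𝓕 G)).const_mul _) fun ξ => ?_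
      simp only
      rw [fourier_shift_sub, norm_mul, mul_pow]
      calc _ ≤ 2 * |2 * π * a * ξ| * ‖𝓕 G ξ‖ ^ 2 := by
            gcongr
            exact norm_exp_sub_one_sq_le _
        _ = _ := by
            rw [abs_mul, abs_of_pos (by positivity : 0 < 2 * π * a)]
            ring
    _ ≤ a * (4 * π * ε ^ 2) := by
      rw [integral_const_mul]
      have := mul_le_mul_of_nonneg_left hI (by positivity : 0 ≤ 4 * π * a)
      linarith

theorem setIntegral_block_le (u : 𝓢(ℝ, ℝ)) {ε : ℝ} (h : BesovNorm u ≤ ε) (j : ℤ) :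
    ∫ ξ in {ξ : ℝ | (2:ℝ) ^ j ≤ |ξ| ∧ |ξ| < (2:ℝ) ^ (j + 1)}, ‖𝓕 (complexify u) ξ‖ ^ 2
      ≤ 2 ^ j * ε ^ 2 := by
  obtain ⟨B, hB⟩ := (𝓕 (complexify u)).decay 0 0
  have hB0 := hB.1.le
  replace hB : ∀ ξ, ‖𝓕 (complexify u) ξ‖ ≤ B := fun ξ => by simpa using hB.2 ξ
  have hI0 : ∀ i : ℤ, 0 ≤ ∫ ξ in {ξ : ℝ | (2:ℝ) ^ i ≤ |ξ| ∧ |ξ| < (2:ℝ) ^ (i + 1)},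
      ‖𝓕 (complexify u) ξ‖ ^ 2 := fun i => integral_nonneg fun _ => sq_nonneg _
  have hterm : ∀ i : ℤ, ((2:ℝ) ^ (-(i:ℝ) / 2)) ^ 2 = ((2:ℝ) ^ i)⁻¹ := fun i => by
    rw [← rpow_natCast, ← rpow_mul (by norm_num), ← rpow_intCast, ← rpow_neg (by norm_num)]
    congr 1
    push_cast
    ring
  have hle : ∀ i : ℤ, ∫ ξ in {ξ : ℝ | (2:ℝ) ^ i ≤ |ξ| ∧ |ξ| < (2:ℝ) ^ (i + 1)},
      ‖𝓕 (complexify u) ξ‖ ^ 2 ≤ 4 * B ^ 2 * 2 ^ i := fun i => by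
    have hsub : {ξ : ℝ | (2:ℝ) ^ i ≤ |ξ| ∧ |ξ| < (2:ℝ) ^ (i + 1)}
        ⊆ Icc (-(2:ℝ) ^ (i + 1)) ((2:ℝ) ^ (i + 1)) := fun ξ hξ => abs_le.1 hξ.2.le
    refine (setIntegral_mono_set (integrable_norm_sq (𝓕 (complexify u))).integrableOn
      (Filter.Eventually.of_forall fun _ => sq_nonneg _) hsub.eventuallyLE).trans ?_
    have hvol : volume (Icc (-(2:ℝ) ^ (i + 1)) ((2:ℝ) ^ (i + 1))) < ⊤ := measure_Icc_lt_top
    refine ((Real.le_norm_self _).trans (norm_setIntegral_le_of_norm_le_const (C := B ^ 2) hvol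
      fun ξ _ => ?_)).trans ?_
    · rw [norm_pow, norm_norm]
      have := hB ξ
      gcongr
    · rw [Real.volume_real_Icc_of_le (by linarith [zpow_pos (by norm_num : (0:ℝ) < 2) (i + 1)]),
        zpow_add_one₀ (by norm_num)]
      linarith
  have hbdd : BddAbove (range fun i : ℤ => (2:ℝ) ^ (-(i:ℝ) / 2) *
      (∫ ξ in {ξ : ℝ | (2:ℝ) ^ i ≤ |ξ| ∧ |ξ| < (2:ℝ) ^ (i + 1)}, ‖FT u ξ‖ ^ 2) ^ (1 / 2 : ℝ)) := by
    refine ⟨2 * B, ?_⟩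
    rintro _ ⟨i, rfl⟩
    simp only [FT_eq_fourier]
    refine le_of_pow_le_pow_left₀ two_ne_zero (by positivity) ?_
    rw [mul_pow, hterm, ← Real.sqrt_eq_rpow]
    refine (mul_le_mul_of_nonneg_left ((sq_sqrt (hI0 i)).le.trans (hle i))
      (by positivity)).trans (le_of_eq ?_)
    field_simp
    ring
  have h1 := (le_ciSup hbdd j).trans h
  simp only [FT_eq_fourier, ← Real.sqrt_eq_rpow] at h1
  have h2 := pow_le_pow_left₀ (by positivity) h1 2
  rw [mul_pow, hterm, inv_mul_le_iff₀ (by positivity)] at h2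
  exact (sq_sqrt (hI0 j)).symm.le.trans h2

theorem exists_shift_sub_primitive (u : 𝓢(ℝ, ℝ)) {U : ℝ → ℝ} (hU : ∀ x, HasDerivAt U (u x) x)
    {a : ℝ} (ha : 0 < a) : ∃ g : 𝓢(ℝ, ℝ), ∀ x, g x = U (x + a) - U x := by
  set h : 𝓢(ℝ, ℝ) := compSubConstCLM ℝ (-a) u - u with hh
  have hd : ∀ x, HasDerivAt (fun x => U (x + a) - U x) (h x) x := fun x => by
    simpa [hh] using ((hU (x + a)).comp_add_const x a).fun_sub (hU x)
  have hderiv : deriv (fun x => U (x + a) - U x) = h := funext fun x => (hd x).deriv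
  refine ⟨⟨fun x => U (x + a) - U x, ?_, ?_⟩, fun x => rfl⟩
  · rw [contDiff_infty_iff_deriv, hderiv]
    exact ⟨fun x => (hd x).differentiableAt, h.smooth ⊤⟩
  · intro k n
    rcases n with _ | n
    · obtain ⟨B, hB⟩ : ∃ B, ∀ ξ, (1 + ‖ξ‖) ^ k * ‖u ξ‖ ≤ B := by
        refine ⟨2 ^ k * ((Finset.Iic (k, 0)).sup fun m => SchwartzMap.seminorm ℝ m.1 m.2) u,
        fun ξ => ?_⟩
        have := one_add_le_sup_seminorm_apply (𝕜 := ℝ) (m := (k, 0)) le_rfl le_rfl u ξ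
        simpa using this
      refine ⟨(1 + a) ^ k * a * B, fun x => ?_⟩
      rw [norm_iteratedFDeriv_zero]
      obtain ⟨ξ, hξ, hξU⟩ := exists_hasDerivAt_eq_slope U u (by linarith : x < x + a)
        (fun x _ => (hU x).continuousAt.continuousWithinAt) fun x _ => hU x
      have h1 : U (x + a) - U x = a * u ξ := by
        rw [hξU, add_sub_cancel_left, mul_div_cancel₀ _ ha.ne']
      have h2 : ‖x‖ ≤ (1 + a) * (1 + ‖ξ‖) := by
        have h3 : |x| ≤ |ξ| + a := by
          have := abs_sub_abs_le_abs_sub x ξ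
          rw [abs_of_nonpos (by linarith [hξ.1] : x - ξ ≤ 0)] at this
          linarith [hξ.2]
        rw [norm_eq_abs, norm_eq_abs]
        nlinarith [abs_nonneg ξ]
      rw [h1, norm_mul, norm_eq_abs a, abs_of_pos ha]
      calc ‖x‖ ^ k * (a * ‖u ξ‖) ≤ ((1 + a) * (1 + ‖ξ‖)) ^ k * (a * ‖u ξ‖) := by gcongr
        _ = (1 + a) ^ k * a * ((1 + ‖ξ‖) ^ k * ‖u ξ‖) := by rw [mul_pow]; ring
        _ ≤ _ := by
          gcongr
          exact hB ξ
    · obtain ⟨B, hB⟩ := h.decay k n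
      refine ⟨B, fun x => ?_⟩
      rw [norm_iteratedFDeriv_eq_norm_iteratedDeriv, iteratedDeriv_succ', hderiv,
        ← norm_iteratedFDeriv_eq_norm_iteratedDeriv]
      exact hB.2 x

theorem norm_fourier_shift_sub_primitive (u : 𝓢(ℝ, ℝ)) {U : ℝ → ℝ}
    (hU : ∀ x, HasDerivAt U (u x) x) {a : ℝ} {g : 𝓢(ℝ, ℝ)} (hg : ∀ x, g x = U (x + a) - U x)
    (ξ : ℝ) :
    2 * π * |ξ| * ‖𝓕 (complexify g) ξ‖
      = ‖Complex.exp (Complex.I * (2 * π * a * ξ : ℝ)) - 1‖ * ‖𝓕 (complexify u) ξ‖ := by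
  have hd : ∀ x, HasDerivAt (complexify g) ((u (x + a) - u x : ℝ) : ℂ) x := fun x => by
    have h1 := (((hU (x + a)).comp_add_const x a).fun_sub (hU x)).ofReal_comp
    refine h1.congr_of_eventuallyEq (Filter.Eventually.of_forall fun y => ?_)
    rw [complexify_apply, hg]
  have hderiv : deriv (complexify g)
      = (compSubConstCLM ℂ (-a) (complexify u) - complexify u : 𝓢(ℝ, ℂ)) := by
    ext x
    rw [(hd x).deriv]
    simp [complexify_apply]
  rw [← norm_mul, ← fourier_shift_sub, fourier_coe (_ - _), ← hderiv,
    Real.fourier_deriv (complexify g).integrable (complexify g).differentiable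
    (by rw [hderiv]; exact SchwartzMap.integrable _)]
  simp [abs_of_pos Real.pi_pos, fourier_coe]

theorem setLIntegral_iUnion_le_of_geometric {F : ℝ → ENNReal} {s : ℕ → Set ℝ} {c : ℝ} (hc : 0 ≤ c)
    (h : ∀ n, ∫⁻ ξ in s n, F ξ ≤ ENNReal.ofReal (c / 2 / 2 ^ n)) :
    ∫⁻ ξ in ⋃ n, s n, F ξ ≤ ENNReal.ofReal c := by
  calc ∫⁻ ξ in ⋃ n, s n, F ξ ≤ ∑' n, ∫⁻ ξ in s n, F ξ := lintegral_iUnion_le _ _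
    _ ≤ ∑' n, ENNReal.ofReal (c / 2 / 2 ^ n) := ENNReal.tsum_le_tsum h
    _ = ENNReal.ofReal c := by
      rw [← ENNReal.ofReal_tsum_of_nonneg (fun n => by positivity) (summable_geometric_two' c),
        tsum_geometric_two']

theorem exists_zpow_le_inv {a : ℝ} (ha : 0 < a) : ∃ J : ℤ, (2:ℝ) ^ J ≤ a⁻¹ ∧ a⁻¹ < 2 ^ (J + 1) :=
  exists_mem_Ico_zpow (inv_pos.2 ha) (by norm_num)

theorem integral_norm_sq_le_of_blocks {G V : 𝓢(ℝ, ℂ)} {a c : ℝ} (ha : 0 < a) (hc : 0 ≤ c)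
    (hlow : ∀ ξ, ξ ≠ 0 → ‖G ξ‖ ≤ a * ‖V ξ‖) (hhigh : ∀ ξ, 2 * |ξ| * ‖G ξ‖ ≤ ‖V ξ‖)
    (hV : ∀ j : ℤ, ∫ ξ in {ξ : ℝ | (2:ℝ) ^ j ≤ |ξ| ∧ |ξ| < (2:ℝ) ^ (j + 1)}, ‖V ξ‖ ^ 2
      ≤ 2 ^ j * c) :
    ∫ ξ, ‖G ξ‖ ^ 2 ≤ 2 * (a * c) := by
  obtain ⟨J, hJ, hJ'⟩ := exists_zpow_le_inv ha
  set B : ℤ → Set ℝ := fun j => {ξ : ℝ | (2:ℝ) ^ j ≤ |ξ| ∧ |ξ| < (2:ℝ) ^ (j + 1)} with hB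
  have hBm : ∀ j, MeasurableSet (B j) := fun j =>
    (measurableSet_le measurable_const measurable_abs).inter
      (measurableSet_lt measurable_abs measurable_const)
  have hblock : ∀ (j : ℤ) (d : ℝ), (∀ ξ ∈ B j, ‖G ξ‖ ^ 2 ≤ d * ‖V ξ‖ ^ 2) → 0 ≤ d →
      ∫⁻ ξ in B j, ENNReal.ofReal (‖G ξ‖ ^ 2) ≤ ENNReal.ofReal (d * (2 ^ j * c)) := by
    intro j d hd hd0
    rw [← ofReal_integral_eq_lintegral_ofReal (integrable_norm_sq G).integrableOn
      (Filter.Eventually.of_forall fun _ => sq_nonneg _)]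
    refine ENNReal.ofReal_le_ofReal ?_
    calc ∫ ξ in B j, ‖G ξ‖ ^ 2 ≤ ∫ ξ in B j, d * ‖V ξ‖ ^ 2 :=
          setIntegral_mono_on (integrable_norm_sq G).integrableOn
            ((integrable_norm_sq V).const_mul d).integrableOn (hBm j) hd
      _ ≤ _ := by
          rw [integral_const_mul]
          exact mul_le_mul_of_nonneg_left (hV j) hd0
  have h2 : (2:ℝ) ≠ 0 := by norm_num
  have hJ1 : a * 2 ^ J ≤ 1 := by
    rwa [← le_div_iff₀' ha, one_div]
  have hJ2 : ((2:ℝ) ^ J)⁻¹ ≤ 2 * a := by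
    rw [zpow_add_one₀ h2, inv_lt_iff_one_lt_mul₀ ha] at hJ'
    rw [inv_le_iff_one_le_mul₀ (by positivity)]
    linarith
  have hL : ∫⁻ ξ in ⋃ n : ℕ, B (J - 1 - n), ENNReal.ofReal (‖G ξ‖ ^ 2)
      ≤ ENNReal.ofReal (a * c) := by
    refine setLIntegral_iUnion_le_of_geometric (by positivity) fun n => ?_
    refine (hblock _ (a ^ 2) (fun ξ hξ => ?_) (by positivity)).trans (ENNReal.ofReal_le_ofReal ?_)
    · rw [← mul_pow]
      have hξ0 : ξ ≠ 0 := abs_pos.1 ((by positivity : (0:ℝ) < 2 ^ (J - 1 - n)).trans_le hξ.1)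
      exact pow_le_pow_left₀ (norm_nonneg _) (hlow ξ hξ0) 2
    · have : a ^ 2 * (2 ^ (J - 1 - (n:ℤ)) * c) = (a * 2 ^ J) * (a * c / 2 / 2 ^ n) := by
        rw [zpow_sub₀ h2, zpow_sub₀ h2, zpow_natCast, zpow_one]
        field_simp
      rw [this]
      exact mul_le_of_le_one_left (by positivity) hJ1
  have hH : ∫⁻ ξ in ⋃ n : ℕ, B (J + n), ENNReal.ofReal (‖G ξ‖ ^ 2) ≤ ENNReal.ofReal (a * c) := by
    refine setLIntegral_iUnion_le_of_geometric (by positivity) fun n => ?_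
    refine (hblock _ ((2 ^ (J + n))⁻¹ ^ 2 / 4) (fun ξ hξ => ?_) (by positivity)).trans
      (ENNReal.ofReal_le_ofReal ?_)
    · have h3 : ‖G ξ‖ ≤ (2 ^ (J + n))⁻¹ / 2 * ‖V ξ‖ := by
        rw [inv_div_left, inv_mul_eq_div, le_div_iff₀ (by positivity)]
        refine le_trans ?_ (hhigh ξ)
        have := mul_le_mul_of_nonneg_right hξ.1 (norm_nonneg (G ξ))
        linarith
      refine (pow_le_pow_left₀ (norm_nonneg _) h3 2).trans (le_of_eq ?_)
      ring
    · have : (2 ^ (J + (n:ℤ)))⁻¹ ^ 2 / 4 * (2 ^ (J + (n:ℤ)) * c)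
          = ((2:ℝ) ^ J)⁻¹ * (c / 4 / 2 ^ n) := by
        rw [zpow_add₀ h2, zpow_natCast]
        field_simp
      rw [this]
      calc ((2:ℝ) ^ J)⁻¹ * (c / 4 / 2 ^ n) ≤ 2 * a * (c / 4 / 2 ^ n) := by gcongr
        _ = _ := by ring
  have hcover : ∀ᵐ ξ : ℝ, ξ ∈ (⋃ n : ℕ, B (J - 1 - n)) ∪ ⋃ n : ℕ, B (J + n) := by
    filter_upwards [compl_mem_ae_iff.2 (measure_singleton (0:ℝ))] with ξ hξ
    obtain ⟨j, hj⟩ := exists_mem_Ico_zpow (abs_pos.2 hξ) (by norm_num : (1:ℝ) < 2)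
    rcases le_or_gt J j with h | h
    · refine Or.inr (mem_iUnion.2 ⟨(j - J).toNat, ?_⟩)
      rw [Int.toNat_of_nonneg (by omega), add_sub_cancel]
      exact hj
    · refine Or.inl (mem_iUnion.2 ⟨(J - 1 - j).toNat, ?_⟩)
      rw [Int.toNat_of_nonneg (by omega), sub_sub_cancel]
      exact hj
  rw [← ENNReal.ofReal_le_ofReal_iff (by positivity), ofReal_integral_eq_lintegral_ofReal
    (integrable_norm_sq G) (Filter.Eventually.of_forall fun _ => sq_nonneg _),
    ← setLIntegral_univ, ← setLIntegral_congr (Filter.eventuallyEq_univ.2 hcover), two_mul,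
    ENNReal.ofReal_add (by positivity) (by positivity)]
  exact (lintegral_union_le _ _ _).trans (add_le_add hL hH)

theorem shiftBound_of_besovNorm_le (u : 𝓢(ℝ, ℝ)) {U : ℝ → ℝ} (hU : ∀ x, HasDerivAt U (u x) x)
    {ε : ℝ} (h : BesovNorm u ≤ ε) : ShiftBound (4 * π * ε ^ 2) U := by
  intro a ha p q hpq
  obtain ⟨g, hg⟩ := exists_shift_sub_primitive u hU ha
  have hF := norm_fourier_shift_sub_primitive u hU hg
  have hπ := Real.pi_gt_three
  have h1 := integral_norm_sq_le_of_blocks (G := 𝓕 (complexify g)) (V := 𝓕 (complexify u)) ha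
    (sq_nonneg ε) (fun ξ hξ => ?_) (fun ξ => ?_) (setIntegral_block_le u h)
  · calc ∫ s in p..q, (U (s + a) - U s) ^ 2 = ∫ s in p..q, g s ^ 2 := by simp only [hg]
      _ ≤ _ := (integral_sq_le_integral_fourier g hpq).trans h1
      _ ≤ _ := by nlinarith [mul_nonneg ha.le (sq_nonneg ε)]
  · have hξ0 : 0 < 2 * π * |ξ| := by positivity
    refine le_of_mul_le_mul_left ?_ hξ0
    rw [hF]
    have h3 : ‖Complex.exp (Complex.I * (2 * π * a * ξ : ℝ)) - 1‖ ≤ 2 * π * |ξ| * a := by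
      refine (Real.norm_exp_I_mul_ofReal_sub_one_le).trans (le_of_eq ?_)
      rw [norm_eq_abs, abs_mul, abs_of_pos (by positivity : 0 < 2 * π * a)]
      ring
    calc _ ≤ 2 * π * |ξ| * a * ‖𝓕 (complexify u) ξ‖ := by gcongr
      _ = _ := by ring
  · have h3 := mul_le_mul_of_nonneg_right (norm_exp_sub_one_le_two (2 * π * a * ξ))
      (norm_nonneg (𝓕 (complexify u) ξ))
    rw [← hF] at h3
    nlinarith [mul_nonneg (abs_nonneg ξ) (norm_nonneg (𝓕 (complexify g) ξ))]

theorem ShiftBound.comp_mul_left {E : ℝ} {g : ℝ → ℝ} (h : ShiftBound E g) {τ : ℝ} (hτ : 0 < τ) :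
    ShiftBound (τ ^ 2 * E) fun y => τ * g (τ * y) := by
  intro a ha p q hpq
  have h1 := h (τ * a) (by positivity) (τ * p) (τ * q) (by gcongr)
  rw [← intervalIntegral.mul_integral_comp_mul_left] at h1
  calc ∫ s in p..q, (τ * g (τ * (s + a)) - τ * g (τ * s)) ^ 2
      = τ * (τ * ∫ s in p..q, (g (τ * s + τ * a) - g (τ * s)) ^ 2) := by
        rw [← intervalIntegral.integral_const_mul, ← intervalIntegral.integral_const_mul]
        congr 1 with s
        rw [mul_add]
        ring
    _ ≤ τ * (τ * a * E) := by gcongr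
    _ = _ := by ring

theorem exists_schwartz_eq_LNL (t : ℝ) (u : 𝓢(ℝ, ℝ)) : ∃ f : 𝓢(ℝ, ℝ), ⇑f = LNL t u := by
  refine ⟨smulLeftCLM ℝ (fun x : ℝ => x) u - (3 * t) • derivCLM ℝ ℝ (derivCLM ℝ ℝ u)
    + (9 * t) • pairing (ContinuousLinearMap.mul ℝ ℝ) u u, ?_⟩
  ext x
  have h1 : ⇑(derivCLM ℝ ℝ u) = deriv u := funext fun y => derivCLM_apply ℝ u y
  simp [LNL, smulLeftCLM_apply_apply (by fun_prop : Function.HasTemperateGrowth fun x : ℝ => x),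
    iteratedDeriv_succ, iteratedDeriv_zero, h1]
  refine Or.inl ?_
  ring

theorem hsNorm_nonneg (s : ℝ) (u : ℝ → ℝ) : 0 ≤ HsNorm s u :=
  rpow_nonneg (integral_nonneg fun _ => by positivity) _

theorem besovNorm_nonneg (u : ℝ → ℝ) : 0 ≤ BesovNorm u :=
  Real.iSup_nonneg fun _ => mul_nonneg (by positivity)
    (rpow_nonneg (integral_nonneg fun _ => by positivity) _)

theorem isSmallSolution_rescale {τ E : ℝ} (hτ : 0 < τ) (u f : 𝓢(ℝ, ℝ)) (hf : ⇑f = LNL (τ ^ 3) u)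
    {U : ℝ → ℝ} (hU : ∀ x, HasDerivAt U (u x) x) (hsU : ShiftBound E U) (hsf : ShiftBound E f)
    (hsmall : ∀ x, τ ^ 2 * |u x| ≤ 1 / 144) :
    IsSmallSolution (τ ^ 2 * E) (fun y => τ * U (τ * y)) (fun y => τ ^ 2 * u (τ * y))
      (fun y => τ ^ 3 * deriv u (τ * y)) (fun y => τ ^ 4 * deriv (deriv u) (τ * y))
      (fun y => τ * f (τ * y)) := by
  have hmul : ∀ y : ℝ, HasDerivAt (fun y => τ * y) τ y := fun y => by
    simpa using (hasDerivAt_id y).const_mul τ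
  have h1 : ⇑(derivCLM ℝ ℝ u) = deriv u := funext fun y => derivCLM_apply ℝ u y
  have h2 : ⇑(derivCLM ℝ ℝ (derivCLM ℝ ℝ u)) = deriv (deriv u) :=
    funext fun y => by rw [derivCLM_apply, h1]
  refine ⟨fun x => ?_, fun x => ?_, fun x => ?_, ?_, fun x => ?_, fun x => ?_,
    hsU.comp_mul_left hτ, hsf.comp_mul_left hτ⟩
  · exact (((hU (τ * x)).comp x (hmul x)).const_mul τ).congr_deriv (by ring)
  · exact (((u.hasDerivAt (τ * x)).comp x (hmul x)).const_mul (τ ^ 2)).congr_deriv (by ring)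
  · have h3 := (derivCLM ℝ ℝ u).hasDerivAt (τ * x)
    rw [h1] at h3
    exact ((h3.comp x (hmul x)).const_mul (τ ^ 3)).congr_deriv (by ring)
  · have h3 := (derivCLM ℝ ℝ (derivCLM ℝ ℝ u)).continuous
    rw [h2] at h3
    fun_prop
  · simp only [hf, LNL, iteratedDeriv_succ, iteratedDeriv_zero]
    ring
  · rw [abs_mul, abs_of_pos (by positivity)]
    exact hsmall _

/-- Nonlinear Klainerman-Sobolev inequality: pointwise decay bounds,
with constant independent of the bootstrap constant `M`. -/
theorem nonlinear_klainerman_sobolev :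
    ∃ C c : ℝ, 0 < C ∧ 0 < c ∧
      ∀ t ε M : ℝ, 0 < t → 0 < ε → 1 ≤ M → M * ε * t ^ ((1:ℝ)/3) ≤ c →
      ∀ u : 𝓢(ℝ, ℝ), Bootstrap M ε t ⇑u →
        BesovNorm ⇑u + HsNorm ((1:ℝ)/2) (LNL t ⇑u) ≤ ε →
        ∀ x : ℝ,
          t ^ ((1:ℝ)/4) * jb t x ^ ((1:ℝ)/4) * |u x|
            + t ^ ((3:ℝ)/4) * jb t x ^ (-(1:ℝ)/4) * |deriv (⇑u) x| ≤ C * ε := by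
  refine ⟨2 * 10 ^ 10, 1 / 144, by norm_num, by norm_num, ?_⟩
  intro t ε M ht hε hM hc u hboot hnorm x
  obtain ⟨τ, hτ, rfl⟩ : ∃ τ : ℝ, 0 < τ ∧ τ ^ 3 = t :=
    ⟨t ^ ((1:ℝ) / 3), by positivity, by rw [← rpow_natCast, ← rpow_mul ht.le]; norm_num⟩
  have hpow : ∀ p : ℝ, (τ ^ 3) ^ p = τ ^ (3 * p) := fun p => by
    rw [← rpow_natCast, ← rpow_mul hτ.le]
    norm_num
  rw [hpow, show (3:ℝ) * (1 / 3) = 1 by norm_num, rpow_one] at hc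
  set ρ : ℝ → ℝ := fun y => (y ^ 2 + 1) ^ ((1:ℝ) / 8) with hρ
  have hρ1 : ∀ y, 1 ≤ ρ y := fun y => one_le_rpow (by nlinarith [sq_nonneg y]) (by norm_num)
  have hρ0 : ∀ y, 0 < ρ y := fun y => one_pos.trans_le (hρ1 y)
  have hρ8 : ∀ y, y ^ 2 + 1 = ρ y ^ 8 := fun y => by
    calc y ^ 2 + 1 = (y ^ 2 + 1) ^ ((1:ℝ) / 8 * (8:ℕ)) := by norm_num
      _ = ρ y ^ 8 := rpow_mul_natCast (by positivity) _ _
  have hjb : ∀ y, jb (τ ^ 3) (τ * y) = τ * ρ y ^ (4:ℝ) := fun y => by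
    rw [jb, hpow, show (3:ℝ) * (2 / 3) = (2:ℕ) by norm_num, rpow_natCast,
      show (τ * y) ^ 2 + τ ^ 2 = τ ^ 2 * (y ^ 2 + 1) by ring, mul_rpow (by positivity)
      (by positivity), ← rpow_natCast, ← rpow_mul hτ.le, hρ, ← rpow_mul (by positivity)]
    norm_num
  have hA : ∀ y, (τ ^ 3) ^ ((1:ℝ) / 4) * jb (τ ^ 3) (τ * y) ^ ((1:ℝ) / 4) = τ * ρ y := fun y => by
    rw [hjb, hpow, mul_rpow hτ.le (by have := hρ0 y; positivity), ← rpow_mul (hρ0 y).le,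
      ← mul_assoc, ← rpow_add hτ]
    norm_num
  have hB : ∀ y, (τ ^ 3) ^ ((3:ℝ) / 4) * jb (τ ^ 3) (τ * y) ^ (-(1:ℝ) / 4) = τ ^ 2 / ρ y :=
      fun y => by
    rw [hjb, hpow, mul_rpow hτ.le (by have := hρ0 y; positivity), ← rpow_mul (hρ0 y).le,
      ← mul_assoc, ← rpow_add hτ, show (3:ℝ) * (3 / 4) + -1 / 4 = (2:ℕ) by norm_num,
      show (4:ℝ) * (-1 / 4) = -1 by norm_num, rpow_natCast, rpow_neg_one, div_eq_mul_inv]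
  have hjb0 : ∀ y, 0 < jb (τ ^ 3) (τ * y) := fun y => by
    rw [hjb]
    have := hρ0 y
    positivity
  have hu : ∀ y, τ * ρ y * |u (τ * y)| ≤ M * ε := fun y => by
    have h1 := (hboot (τ * y)).1
    rw [mul_assoc, neg_div, rpow_neg (by positivity), rpow_neg (hjb0 y).le, ← mul_inv, hA,
      ← div_eq_mul_inv, le_div_iff₀ (by have := hρ0 y; positivity)] at h1
    linarith
  have hu₁ : ∀ y, τ ^ 2 / ρ y * |deriv u (τ * y)| ≤ M * ε := fun y => by
    have h1 := (hboot (τ * y)).2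
    have h2 : (τ ^ 3) ^ (-(3:ℝ) / 4) * jb (τ ^ 3) (τ * y) ^ ((1:ℝ) / 4) = (τ ^ 2 / ρ y)⁻¹ := by
      rw [← hB, neg_div, rpow_neg (by positivity), neg_div, rpow_neg (hjb0 y).le, mul_inv, inv_inv]
    rw [mul_assoc, h2, ← div_eq_mul_inv, le_div_iff₀ (by have := hρ0 y; positivity)] at h1
    linarith
  obtain ⟨f, hf⟩ := exists_schwartz_eq_LNL (τ ^ 3) u
  have hU : ∀ x, HasDerivAt (fun x => ∫ s in (0:ℝ)..x, u s) (u x) x := fun x =>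
    intervalIntegral.integral_hasDerivAt_right (u.continuous.intervalIntegrable _ _)
      u.continuous.stronglyMeasurable.stronglyMeasurableAtFilter u.continuous.continuousAt
  have hsol := isSmallSolution_rescale hτ u f hf hU
    (shiftBound_of_besovNorm_le u hU (by linarith [hsNorm_nonneg ((1:ℝ) / 2) (LNL (τ ^ 3) u)]))
    (shiftBound_of_hsNorm_le f hε.le (by rw [hf]; linarith [besovNorm_nonneg u])) fun y => by
      have h1 := hu (y / τ)
      rw [mul_div_cancel₀ _ hτ.ne'] at h1
      calc τ ^ 2 * |u y| ≤ τ ^ 2 * (ρ (y / τ) * |u y|) := by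
            gcongr
            exact le_mul_of_one_le_left (abs_nonneg _) (hρ1 _)
        _ = τ * (τ * ρ (y / τ) * |u y|) := by ring
        _ ≤ τ * (M * ε) := by gcongr
        _ ≤ _ := by linarith
  have hsum : ∀ y, ρ y ^ 2 * (τ ^ 2 * u (τ * y)) ^ 2 + (τ ^ 3 * deriv u (τ * y)) ^ 2 / ρ y ^ 2
      = τ ^ 2 * ((τ * ρ y * |u (τ * y)|) ^ 2 + (τ ^ 2 / ρ y * |deriv u (τ * y)|) ^ 2) := fun y => by
    rw [mul_pow _ |_|, mul_pow _ |_|, sq_abs, sq_abs]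
    ring
  have hmain := hsol.weighted_sq_le hρ1 hρ8 (X := τ ^ 2 * ((M * ε) ^ 2 + (M * ε) ^ 2))
    (fun y => by
      rw [hsum]
      have h1 := hu y
      have h2 := hu₁ y
      have := hρ0 y
      gcongr) (x / τ)
  rw [hsum] at hmain
  have hA' := hA (x / τ)
  have hB' := hB (x / τ)
  rw [mul_div_cancel₀ _ hτ.ne'] at hmain hA' hB'
  rw [hA', hB']
  refine le_of_pow_le_pow_left₀ two_ne_zero (by positivity) ?_
  generalize τ * ρ (x / τ) * |u x| = v at hmain ⊢
  generalize τ ^ 2 / ρ (x / τ) * |deriv u x| = w at hmain ⊢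
  have h1 : v ^ 2 + w ^ 2 ≤ 10 ^ 19 * (4 * π * ε ^ 2) := by
    refine le_of_mul_le_mul_left ?_ (by positivity : 0 < τ ^ 2)
    linarith
  have h2 : π * ε ^ 2 ≤ 4 * ε ^ 2 := by
    gcongr
    exact Real.pi_le_four
  nlinarith [sq_nonneg (v - w)]
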